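/- Let D be a compact subset of the set of parameter tuples (a₁₁, a₀₂, a₃₀, a₂₁, a₁₂, a₀₃) ∈ ℝ⁶ satisfying a₃₀ > 0, a₁₁² − 8a₃₀ < 0, and |a₂₁| + |a₀₃| + |a₁₁·a₀₂| > 0. Then there exists a neighborhood V of the origin in ℝ² such that, for every parameter tuple in D, the Kukles-type system x' = y, y' = −(a₁₁xy + a₀₂y² + a₃₀x³ + a₂₁x²y + a₁₂xy² + a₀₃y³) has at most 3 limit cycles contained in V. -/

import Mathlib

open Set Metric

/-- A solution of the Kukles-type system (4.1):
`x' = y`, `y' = -(a₁₁xy + a₀₂y² + a₃₀x³ + a₂₁x²y + a₁₂xy² + a₀₃y³)`. -/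
def IsKuklesSolution (a11 a02 a30 a21 a12 a03 : ℝ) (γ : ℝ → ℝ × ℝ) : Prop :=
  ∀ t : ℝ,
    HasDerivAt (fun s => (γ s).1) (γ t).2 t ∧
    HasDerivAt (fun s => (γ s).2)
      (-(a11 * (γ t).1 * (γ t).2 + a02 * (γ t).2 ^ 2 + a30 * (γ t).1 ^ 3 +
          a21 * (γ t).1 ^ 2 * (γ t).2 + a12 * (γ t).1 * (γ t).2 ^ 2 +
          a03 * (γ t).2 ^ 3)) t

/-- A periodic orbit of (4.1): the image of a nonconstant periodic solution. -/
def IsKuklesPeriodicOrbit (a11 a02 a30 a21 a12 a03 : ℝ) (Γ : Set (ℝ × ℝ)) : Prop :=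
  ∃ (γ : ℝ → ℝ × ℝ) (T : ℝ), 0 < T ∧
    IsKuklesSolution a11 a02 a30 a21 a12 a03 γ ∧
    Function.Periodic γ T ∧ (∃ t, γ t ≠ γ 0) ∧ Γ = Set.range γ

/-- A limit cycle of (4.1): an isolated periodic orbit. -/
def IsKuklesLimitCycle (a11 a02 a30 a21 a12 a03 : ℝ) (Γ : Set (ℝ × ℝ)) : Prop :=
  IsKuklesPeriodicOrbit a11 a02 a30 a21 a12 a03 Γ ∧
  ∃ U : Set (ℝ × ℝ), IsOpen U ∧ Γ ⊆ U ∧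
    ∀ Γ' : Set (ℝ × ℝ), IsKuklesPeriodicOrbit a11 a02 a30 a21 a12 a03 Γ' → Γ' ⊆ U → Γ' = Γ

/-- Continuous functions on `[0, π]`. -/
abbrev ArcFun : Type := C(Icc (0 : ℝ) Real.pi, ℝ)

namespace ArcFun

/-- The endpoint `π` of the interval. -/
noncomputable def endpt : Icc (0 : ℝ) Real.pi := ⟨Real.pi, Real.pi_pos.le, le_rfl⟩

/-- The constant extension of a function on `[0, π]` to the real line. -/
noncomputable def ext (f : ArcFun) (t : ℝ) : ℝ := f (projIcc 0 Real.pi Real.pi_pos.le t)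

lemma continuous_ext (f : ArcFun) : Continuous f.ext :=
  f.continuous.comp continuous_projIcc

lemma ext_coe (f : ArcFun) (t : Icc (0 : ℝ) Real.pi) : f.ext t = f t := by
  simp [ext]

lemma ext_of_mem (f : ArcFun) {t : ℝ} (ht : t ∈ Icc (0 : ℝ) Real.pi) : f.ext t = f ⟨t, ht⟩ := by
  simp [ext, projIcc_of_mem _ ht]

/-- The primitive of the constant extension, vanishing at `0`. -/
noncomputable def prim (f : ArcFun) (t : ℝ) : ℝ := ∫ s in (0 : ℝ)..t, f.ext s

lemma hasDerivAt_prim (f : ArcFun) (t : ℝ) : HasDerivAt f.prim (f.ext t) t :=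
  intervalIntegral.integral_hasDerivAt_right (f.continuous_ext.intervalIntegrable _ _)
    (f.continuous_ext.stronglyMeasurableAtFilter _ _) f.continuous_ext.continuousAt

lemma prim_zero (f : ArcFun) : f.prim 0 = 0 := by simp [prim]

lemma continuous_prim (f : ArcFun) : Continuous f.prim :=
  continuous_iff_continuousAt.2 fun t => (f.hasDerivAt_prim t).continuousAt

/-- The Volterra integration operator `f ↦ (t ↦ ∫₀ᵗ f)`. -/
noncomputable def volterra : ArcFun →L[ℝ] ArcFun :=
  LinearMap.mkContinuous
    { toFun := fun f => ⟨fun t => f.prim t, f.continuous_prim.comp continuous_subtype_val⟩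
      map_add' := fun f g => by
        ext t
        exact intervalIntegral.integral_add (f.continuous_ext.intervalIntegrable _ _)
          (g.continuous_ext.intervalIntegrable _ _)
      map_smul' := fun c f => by
        ext t
        exact intervalIntegral.integral_const_mul c f.ext }
    Real.pi
    (fun f => by
      rw [ContinuousMap.norm_le _ (by positivity)]
      intro t
      have h : ‖∫ s in (0 : ℝ)..t, f.ext s‖ ≤ ‖f‖ * |(t : ℝ) - 0| :=
        intervalIntegral.norm_integral_le_of_norm_le_const fun s _ => f.norm_coe_le_norm _
      have h2 : |(t : ℝ) - 0| ≤ Real.pi := by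
        rw [sub_zero, abs_of_nonneg t.2.1]; exact t.2.2
      calc _ ≤ ‖f‖ * |(t : ℝ) - 0| := h
        _ ≤ ‖f‖ * Real.pi := by gcongr
        _ = _ := mul_comm _ _)

lemma volterra_apply (f : ArcFun) (t : Icc (0 : ℝ) Real.pi) : volterra f t = f.prim t := rfl

lemma eq_volterra_of_hasDerivAt (f g : ArcFun) (u : ℝ → ℝ) (hfu : ∀ t, f t = u t)
    (h0 : u 0 = 0) (hu : ∀ t : Icc (0 : ℝ) Real.pi, HasDerivAt u (g t) t) : f = volterra g := by
  ext t
  rw [volterra_apply, hfu]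
  have h : ∫ s in (0 : ℝ)..t, g.ext s = u t - u 0 := by
    apply intervalIntegral.integral_eq_sub_of_hasDerivAt
    · intro s hs
      rw [uIcc_of_le t.2.1] at hs
      have hs' : s ∈ Icc (0 : ℝ) Real.pi := ⟨hs.1, hs.2.trans t.2.2⟩
      rw [ext_of_mem _ hs']
      exact hu ⟨s, hs'⟩
    · exact g.continuous_ext.intervalIntegrable _ _
  rw [prim, h, h0, sub_zero]

lemma volterra_mul_volterra (f g : ArcFun) :
    volterra f * volterra g = volterra (f * volterra g + volterra f * g) := by
  refine eq_volterra_of_hasDerivAt _ _ (fun t => f.prim t * g.prim t) (fun t => rfl)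
    (by simp [prim_zero]) fun t => ?_
  have := (f.hasDerivAt_prim t).fun_mul (g.hasDerivAt_prim t)
  simpa [ext_coe, volterra_apply] using this

/-- The solution of the linear scalar equation `u' = κ u`, `u(0) = 1`. -/
noncomputable def expPrim (κ : ArcFun) : ArcFun :=
  ⟨fun t => Real.exp (volterra κ t), Real.continuous_exp.comp (volterra κ).continuous⟩

lemma expPrim_pos (κ : ArcFun) (t) : 0 < expPrim κ t := Real.exp_pos _

lemma expPrim_mul_neg (κ : ArcFun) : expPrim κ * expPrim (-κ) = 1 := by
  ext t
  simp [expPrim, ← Real.exp_add]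

lemma expPrim_eq (κ : ArcFun) : expPrim κ = 1 + volterra (κ * expPrim κ) := by
  rw [← eq_volterra_of_hasDerivAt (expPrim κ - 1) _ (fun t => Real.exp (κ.prim t) - 1)]
  · abel
  · intro t; simp [expPrim, volterra_apply]
  · simp [prim_zero]
  · intro t
    have := ((κ.hasDerivAt_prim t).exp).sub_const 1
    simpa [ext_coe, expPrim, volterra_apply, mul_comm] using this

lemma eq_of_linear_volterra {κ v f : ArcFun} (h : v = volterra (κ * v + f)) :
    v = expPrim κ * volterra (expPrim (-κ) * f) := by
  set E := expPrim κ
  set E' := expPrim (-κ) with hE'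
  have hEE : E * E' = 1 := expPrim_mul_neg κ
  have h1 : E' = 1 - volterra (κ * E') := by
    have := expPrim_eq (-κ)
    rw [neg_mul, map_neg] at this
    rw [sub_eq_add_neg]; exact this
  have h2 : E' * v = volterra (E' * f) := by
    set g := κ * v + f
    have h3 : volterra g * volterra (κ * E') = volterra g - volterra (E' * f) := by
      rw [volterra_mul_volterra, ← h]
      have : volterra (κ * E') = 1 - E' := by rw [← sub_eq_zero]; linear_combination h1
      rw [this]
      nth_rewrite 2 [h]
      rw [← map_sub]
      congr 1
      simp only [g]; ring
    have h4 : v * E' = v - v * volterra (κ * E') := by linear_combination v * h1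
    rw [← h] at h3
    linear_combination h4 - h3
  rw [← h2, ← mul_assoc, hEE, one_mul]

lemma linear_volterra_sol (κ f : ArcFun) :
    expPrim κ * volterra (expPrim (-κ) * f) =
      volterra (κ * (expPrim κ * volterra (expPrim (-κ) * f)) + f) := by
  set E := expPrim κ
  set h := expPrim (-κ) * f
  have hEE : E * h = f := by
    simp only [h, E]; rw [← mul_assoc, expPrim_mul_neg, one_mul]
  have h1 : volterra (κ * E) = E - 1 := by rw [eq_sub_iff_add_eq', ← expPrim_eq]
  have h2 := volterra_mul_volterra (κ * E) h
  rw [h1] at h2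
  have h3 : E * volterra h = volterra h + volterra (κ * E * volterra h + (E - 1) * h) := by
    rw [← h2]; ring
  rw [← map_add] at h3
  calc E * volterra h = volterra (h + (κ * E * volterra h + (E - 1) * h)) := h3
    _ = _ := by congr 1; rw [← hEE]; ring

/-- The operator `v ↦ v - ∫ κ v` is invertible. -/
noncomputable def volterraEquiv (κ : ArcFun) : ArcFun ≃L[ℝ] ArcFun :=
  ContinuousLinearEquiv.equivOfInverse
    (ContinuousLinearMap.id ℝ ArcFun - volterra ∘L ContinuousLinearMap.mul ℝ ArcFun κ)
    (ContinuousLinearMap.id ℝ ArcFun + ContinuousLinearMap.mul ℝ ArcFun (expPrim κ) ∘L volterra ∘L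
      ContinuousLinearMap.mul ℝ ArcFun (expPrim (-κ) * κ))
    (fun v => by
      simp only [add_apply, sub_apply,
        ContinuousLinearMap.comp_apply, ContinuousLinearMap.mul_apply',
        ContinuousLinearMap.id_apply]
      set g := v - volterra (κ * v) with hg
      have h1 : volterra (κ * v) = volterra (κ * volterra (κ * v) + κ * g) := by
        congr 1; rw [hg]; ring
      have h2 := eq_of_linear_volterra h1
      rw [mul_assoc, ← h2, hg]; abel)
    (fun g => by
      simp only [add_apply, sub_apply,
        ContinuousLinearMap.comp_apply, ContinuousLinearMap.mul_apply',
        ContinuousLinearMap.id_apply]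
      have h1 := linear_volterra_sol κ (κ * g)
      rw [mul_assoc]
      set w := expPrim κ * volterra (expPrim (-κ) * (κ * g))
      rw [show κ * (g + w) = κ * w + κ * g by ring, ← h1]; abel)

lemma volterraEquiv_apply (κ v : ArcFun) : volterraEquiv κ v = v - volterra (κ * v) := rfl

end ArcFun

namespace ArcFun

open Topology in
/-- Smooth dependence on parameters for `ρ = 1 + ∫ F(p, ρ)` near a parameter value at which the
equation is linear in `ρ`. -/
lemma exists_sol {E : Type*} [NormedAddCommGroup E] [NormedSpace ℝ E] [CompleteSpace E]
    {F : E × ArcFun → ArcFun} {κ : ArcFun} {p₀ : E} {n : WithTop ℕ∞} (hn : n ≠ 0)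
    (hF : ContDiffAt ℝ n F (p₀, expPrim κ)) (hlin : ∀ ρ, F (p₀, ρ) = κ * ρ) :
    ∃ sol : E → ArcFun, ContDiffAt ℝ n sol p₀ ∧ sol p₀ = expPrim κ ∧
      (∀ᶠ p in 𝓝 p₀, sol p = 1 + volterra (F (p, sol p))) ∧
      ∀ (h : E) (f : ArcFun), HasDerivAt (fun s : ℝ => F (p₀ + s • h, expPrim κ)) f 0 →
        fderiv ℝ sol p₀ h = expPrim κ * volterra (expPrim (-κ) * f) := by
  set ρ₀ := expPrim κ with hρ₀
  set Φ : E × ArcFun → ArcFun := fun z => z.2 - 1 - volterra (F z) with hΦ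
  have hΦc : ContDiffAt ℝ n Φ (p₀, ρ₀) :=
    (contDiffAt_snd.sub contDiffAt_const).sub (volterra.contDiff.contDiffAt.comp _ hF)
  have hΦ0 : Φ (p₀, ρ₀) = 0 := by
    simp only [hΦ, hlin]
    rw [sub_sub, sub_eq_zero]; exact expPrim_eq κ
  have hFd : HasFDerivAt F (fderiv ℝ F (p₀, ρ₀)) (p₀, ρ₀) := (hF.differentiableAt hn).hasFDerivAt
  have hinr : fderiv ℝ F (p₀, ρ₀) ∘L .inr ℝ E ArcFun = ContinuousLinearMap.mul ℝ ArcFun κ := by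
    have h1 : HasFDerivAt (fun ρ => F (p₀, ρ)) (fderiv ℝ F (p₀, ρ₀) ∘L .inr ℝ E ArcFun) ρ₀ :=
      hFd.comp ρ₀ (hasFDerivAt_prodMk_right p₀ ρ₀)
    have h2 : HasFDerivAt (fun ρ => F (p₀, ρ)) (ContinuousLinearMap.mul ℝ ArcFun κ) ρ₀ := by
      have := (ContinuousLinearMap.mul ℝ ArcFun κ).hasFDerivAt (x := ρ₀)
      refine this.congr_of_eventuallyEq (Filter.Eventually.of_forall fun ρ => ?_)
      simp [hlin]
    exact h1.unique h2
  have hΦd : fderiv ℝ Φ (p₀, ρ₀) =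
      ContinuousLinearMap.snd ℝ E ArcFun - volterra ∘L fderiv ℝ F (p₀, ρ₀) :=
    ((hasFDerivAt_snd.sub_const 1).sub (volterra.hasFDerivAt.comp _ hFd)).fderiv
  have hinv : (fderiv ℝ Φ (p₀, ρ₀) ∘L .inr ℝ E ArcFun).IsInvertible := by
    refine ⟨volterraEquiv κ, ?_⟩
    ext1 v
    have := congrArg (fun L => L v) hinr
    simp only [ContinuousLinearMap.comp_apply, ContinuousLinearMap.mul_apply'] at this
    rw [hΦd]
    simp [volterraEquiv_apply, ← this]
  let sol := hΦc.implicitFunction hn hinv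
  have hsol0 : sol p₀ = ρ₀ := hΦc.implicitFunction_apply_self hn hinv
  have hsolc : ContDiffAt ℝ n sol p₀ := hΦc.contDiffAt_implicitFunction hn hinv
  have hev : ∀ᶠ p in 𝓝 p₀, sol p = 1 + volterra (F (p, sol p)) := by
    filter_upwards [hΦc.eventually_apply_implicitFunction hn hinv] with p hp
    have : Φ (p, sol p) = 0 := hp.trans hΦ0
    simp only [hΦ, sub_sub, sub_eq_zero] at this
    exact this
  refine ⟨sol, hsolc, hsol0, hev, fun h f hf => ?_⟩
  apply eq_of_linear_volterra
  have hsd : HasFDerivAt sol (fderiv ℝ sol p₀) p₀ := (hsolc.differentiableAt hn).hasFDerivAt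
  have hFd' : HasFDerivAt F (fderiv ℝ F (p₀, ρ₀)) (p₀, sol p₀) := by rw [hsol0]; exact hFd
  have h1 := (volterra.hasFDerivAt.comp p₀
    (hFd'.comp p₀ ((hasFDerivAt_id p₀).prodMk hsd))).const_add 1
  have h2 := (hsd.congr_of_eventuallyEq (hev.mono fun p hp => hp.symm)).unique h1
  have h3 := congrArg (fun L => L h) h2
  have h4 : fderiv ℝ F (p₀, ρ₀) (h, 0) = f := by
    have hline : HasDerivAt (fun s : ℝ => (p₀ + s • h, ρ₀)) (h, (0 : ArcFun)) 0 := by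
      have := ((hasDerivAt_id (0 : ℝ)).smul_const h).const_add p₀
      rw [one_smul] at this
      exact this.prodMk (hasDerivAt_const _ _)
    have hFd2 : HasFDerivAt F (fderiv ℝ F (p₀, ρ₀)) (p₀ + (0 : ℝ) • h, ρ₀) := by simpa using hFd
    exact (hFd2.comp_hasDerivAt (0 : ℝ) hline).unique hf
  have h5 : ∀ v, fderiv ℝ F (p₀, ρ₀) (0, v) = κ * v := fun v => congrArg (fun L => L v) hinr
  refine h3.trans ?_
  simp only [ContinuousLinearMap.comp_apply, ContinuousLinearMap.prod_apply,
    ContinuousLinearMap.id_apply]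
  congr 1
  rw [← h4, ← h5, add_comm, ← map_add]
  simp

end ArcFun

namespace ArcFun

/-- The sine function on `[0, π]`. -/
noncomputable def sinI : ArcFun := ⟨fun t => Real.sin t, by fun_prop⟩

/-- The cosine function on `[0, π]`. -/
noncomputable def cosI : ArcFun := ⟨fun t => Real.cos t, by fun_prop⟩

lemma sinI_apply (t) : sinI t = Real.sin t := rfl

lemma cosI_apply (t) : cosI t = Real.cos t := rfl

lemma two_apply (t) : (2 : ArcFun) t = 2 := rfl

open Topology in
lemma eventually_pos {f : ArcFun} (hf : ∀ t, 0 < f t) : ∀ᶠ g in 𝓝 f, ∀ t, 0 < (g : ArcFun) t := by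
  have h : IsOpen {g : ArcFun | MapsTo g univ (Ioi 0)} :=
    ContinuousMap.isOpen_setOfPred_mapsTo isCompact_univ isOpen_Ioi
  filter_upwards [h.mem_nhds (fun t _ => hf t)] with g hg t using hg (mem_univ t)

lemma isUnit_of_pos {f : ArcFun} (hf : ∀ t, 0 < f t) : IsUnit f :=
  ContinuousMap.isUnit_iff_forall_ne_zero f |>.2 fun t => (hf t).ne'

lemma inverse_apply {f : ArcFun} (hf : ∀ t, 0 < f t) (t) : Ring.inverse f t = (f t)⁻¹ := by
  have h := Ring.mul_inverse_cancel f (isUnit_of_pos hf)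
  have h2 := congrArg (fun g : ArcFun => g t) h
  simp only [ContinuousMap.mul_apply, ContinuousMap.one_apply] at h2
  exact eq_inv_of_mul_eq_one_right h2

/-- The denominator of the quasi-polar equation. -/
noncomputable def polarDen (M N : ArcFun) : ArcFun := 2 * cosI ^ 2 * M + sinI * N

/-- The right-hand side of the quasi-polar equation. -/
noncomputable def polarField (M N ρ : ArcFun) : ArcFun :=
  ρ * cosI * (sinI * M - N) * Ring.inverse (polarDen M N)

lemma polarDen_pos {a g : ℝ} (hag : a ^ 2 < 8 * g) (t) :
    0 < polarDen 1 (a • (sinI * cosI) + g • sinI ^ 3) t := by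
  have h : polarDen 1 (a • (sinI * cosI) + g • sinI ^ 3) t =
      2 * Real.cos t ^ 2 + a * Real.sin t ^ 2 * Real.cos t + g * Real.sin t ^ 4 := by
    simp [polarDen, sinI_apply, cosI_apply, two_apply]; ring
  rw [h]
  have h1 := Real.sin_sq_add_cos_sq (t : ℝ)
  by_cases hs : Real.sin t = 0
  · rw [hs] at h1 ⊢; nlinarith
  · have : 0 < Real.sin t ^ 4 := by positivity
    nlinarith [sq_nonneg (4 * Real.cos t + a * Real.sin t ^ 2), mul_pos this (sub_pos.2 hag)]

/-- What a solution of the quasi-polar equation is required to satisfy. -/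
structure IsPolarArc (M N ρ : ArcFun) : Prop where
  pos : ∀ t, 0 < ρ t
  pos_mass : ∀ t, 0 < M t
  pos_den : ∀ t, 0 < polarDen M N t
  eq : ρ = 1 + volterra (polarField M N ρ)

open Topology in
theorem exists_flow {E : Type*} [NormedAddCommGroup E] [NormedSpace ℝ E] [CompleteSpace E]
    {M N : E × ArcFun → ArcFun} {p₀ : E} {a g : ℝ} (hag : a ^ 2 < 8 * g) {n : WithTop ℕ∞}
    (hn : n ≠ 0) (hM : ContDiff ℝ n M) (hN : ContDiff ℝ n N) (hM0 : ∀ ρ, M (p₀, ρ) = 1)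
    (hN0 : ∀ ρ, N (p₀, ρ) = a • (sinI * cosI) + g • sinI ^ 3) :
    ∃ sol : E → ArcFun, ContDiffAt ℝ n sol p₀ ∧
      (∀ᶠ p in 𝓝 p₀, IsPolarArc (M (p, sol p)) (N (p, sol p)) (sol p)) ∧
      ∀ (h : E) (c : ℝ) (w : ℕ), c ≠ 0 → (∀ (s : ℝ) ρ, M (p₀ + s • h, ρ) = 1) →
        (∀ (s : ℝ) ρ, N (p₀ + s • h, ρ) =
          N (p₀, ρ) + (s * c) • (ρ ^ w * sinI ^ (w + 1) * cosI)) →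
        fderiv ℝ sol p₀ h endpt ≠ 0 := by
  set q : ArcFun := a • (sinI * cosI) + g • sinI ^ 3 with hq
  set D : ArcFun := polarDen 1 q with hD
  have hDpos : ∀ t, 0 < D t := polarDen_pos hag
  obtain ⟨u, hu⟩ := isUnit_of_pos hDpos
  set κ : ArcFun := cosI * (sinI - q) * Ring.inverse D with hκ
  set F : E × ArcFun → ArcFun := fun z => polarField (M z) (N z) z.2 with hF
  have hden : ContDiff ℝ n (fun z => polarDen (M z) (N z)) := by
    unfold polarDen
    exact (contDiff_const.mul hM).add (contDiff_const.mul hN)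
  have hFc : ContDiffAt ℝ n F (p₀, expPrim κ) := by
    have h1 : ContDiffAt ℝ n Ring.inverse (polarDen (M (p₀, expPrim κ)) (N (p₀, expPrim κ))) := by
      rw [hM0, hN0, ← hD, ← hu]; exact contDiffAt_ringInverse ℝ u
    have h2 := h1.comp (p₀, expPrim κ) hden.contDiffAt
    simp only [hF, polarField]
    exact ((contDiffAt_snd.mul contDiffAt_const).mul
      ((contDiffAt_const.mul hM.contDiffAt).sub hN.contDiffAt)).mul h2
  have hlin : ∀ ρ, F (p₀, ρ) = κ * ρ := by
    intro ρ
    simp only [hF, polarField, hM0, hN0, hκ, hD]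
    ring
  obtain ⟨sol, hc, h0, hev, hd⟩ := exists_sol hn hFc hlin
  have hcont : ContinuousAt (fun p => (p, sol p)) p₀ := continuousAt_id.prodMk hc.continuousAt
  refine ⟨sol, hc, ?_, ?_⟩
  · have e1 := hc.continuousAt.eventually (eventually_pos (f := sol p₀)
      (by rw [h0]; exact expPrim_pos κ))
    have e2 := (hM.continuous.continuousAt.comp hcont).eventually
      (eventually_pos (by simp [hM0]))
    have e3 := (hden.continuous.continuousAt.comp hcont).eventually
      (eventually_pos (by simpa [hM0, hN0] using hDpos))
    filter_upwards [hev, e1, e2, e3] with p a1 a2 a3 a4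
    exact ⟨a2, a3, a4, a1⟩
  · intro h c w hcne hMs hNs
    set ρ := expPrim κ with hρ
    have hρpos : ∀ t, 0 < ρ t := expPrim_pos κ
    set m : ArcFun := c • (ρ ^ w * sinI ^ (w + 1) * cosI) with hm
    set f : ArcFun := -(ρ * cosI * m * (2 * cosI ^ 2 + sinI ^ 2) * Ring.inverse D ^ 2) with hf
    have hDi : D * Ring.inverse D = 1 := Ring.mul_inverse_cancel D (isUnit_of_pos hDpos)
    have hder : HasDerivAt (fun s : ℝ => F (p₀ + s • h, ρ)) f 0 := by
      have hform : ∀ s : ℝ, F (p₀ + s • h, ρ) =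
          (ρ * cosI * (sinI - q) - s • (ρ * cosI * m)) * Ring.inverse (D + s • (sinI * m)) := by
        intro s
        have hns : N (p₀ + s • h, ρ) = q + s • m := by rw [hNs, hN0, hm, smul_smul]
        simp only [hF, polarField, polarDen, hMs, hns]
        congr 1
        · simp only [mul_one]; rw [← mul_smul_comm]; ring
        · congr 1
          rw [hD, polarDen, mul_add, mul_smul_comm]; ring
      have hl1 : HasDerivAt (fun s : ℝ => ρ * cosI * (sinI - q) - s • (ρ * cosI * m))
          (-(ρ * cosI * m)) 0 := by
        have := ((hasDerivAt_id (0 : ℝ)).smul_const (ρ * cosI * m)).const_sub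
          (ρ * cosI * (sinI - q))
        rw [one_smul] at this
        exact this
      have hl2 : HasDerivAt (fun s : ℝ => D + s • (sinI * m)) (sinI * m) 0 := by
        have := ((hasDerivAt_id (0 : ℝ)).smul_const (sinI * m)).const_add D
        rw [one_smul] at this
        exact this
      have hl3 : HasDerivAt (fun s : ℝ => Ring.inverse (D + s • (sinI * m)))
          (-(Ring.inverse D * (sinI * m) * Ring.inverse D)) 0 := by
        have h1 := hasFDerivAt_ringInverse (𝕜 := ℝ) u
        have h2 : HasFDerivAt Ring.inverse (-ContinuousLinearMap.mulLeftRight ℝ ArcFun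
            (↑u⁻¹ : ArcFun) (↑u⁻¹ : ArcFun)) (D + (0 : ℝ) • (sinI * m)) := by
          rw [zero_smul, add_zero, ← hu]; exact h1
        have h3 := h2.comp_hasDerivAt (0 : ℝ) hl2
        have h4 : Ring.inverse D = ↑u⁻¹ := by rw [← hu, Ring.inverse_unit]
        rw [h4]
        exact h3.congr_deriv (by simp [ContinuousLinearMap.mulLeftRight_apply])
      have hl4 := hl1.mul hl3
      refine (hl4.congr_of_eventuallyEq (Filter.Eventually.of_forall hform)).congr_deriv ?_
      simp only [zero_smul, add_zero, sub_zero, hf]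
      have hq' : D = 2 * cosI ^ 2 + sinI * q := by simp [hD, polarDen]
      have h5 : sinI * q = D - 2 * cosI ^ 2 := by rw [hq']; ring
      linear_combination (ρ * cosI * m * Ring.inverse D ^ 2) * h5 +
        (ρ * cosI * m * Ring.inverse D) * hDi
    rw [hd h f hder, ContinuousMap.mul_apply, volterra_apply]
    apply mul_ne_zero (expPrim_pos κ _).ne'
    set G : ArcFun := c • (expPrim (-κ) * f) with hG
    have hval : ∀ t, G t = -(c ^ 2 * (expPrim (-κ) t * ρ t ^ (w + 1) * Real.sin t ^ (w + 1) *
        Real.cos t ^ 2 * (2 * Real.cos t ^ 2 + Real.sin t ^ 2) * (D t)⁻¹ ^ 2)) := by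
      intro t
      simp [hG, hf, hm, sinI_apply, cosI_apply, two_apply, inverse_apply hDpos]
      ring
    have hpos : 0 < ∫ s in (0 : ℝ)..Real.pi, -G.ext s := by
      apply intervalIntegral.integral_pos Real.pi_pos G.continuous_ext.neg.continuousOn
      · intro s hs
        have hs' : s ∈ Icc (0 : ℝ) Real.pi := Ioc_subset_Icc_self hs
        rw [Pi.neg_apply, ext_of_mem _ hs', hval, neg_neg]
        have h1 := (expPrim_pos (-κ) ⟨s, hs'⟩).le
        have h2 := (hρpos ⟨s, hs'⟩).le
        have h3 := Real.sin_nonneg_of_mem_Icc hs'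
        positivity
      · have hs' : Real.pi / 4 ∈ Icc (0 : ℝ) Real.pi :=
          ⟨by positivity, by linarith [Real.pi_pos]⟩
        refine ⟨Real.pi / 4, hs', ?_⟩
        rw [Pi.neg_apply, ext_of_mem _ hs', hval, neg_neg]
        have h1 := expPrim_pos (-κ) ⟨_, hs'⟩
        have h2 := hρpos ⟨_, hs'⟩
        have h3 := hDpos ⟨_, hs'⟩
        simp only [Real.sin_pi_div_four, Real.cos_pi_div_four]
        positivity
    intro hzero
    have h7 : G.prim endpt = 0 := by
      have := congrArg (fun L : ArcFun => L endpt)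
        (volterra.map_smul c (expPrim (-κ) * f))
      rw [← hG] at this
      simp only [volterra_apply, ContinuousMap.smul_apply, hzero] at this
      simpa using this
    rw [intervalIntegral.integral_neg] at hpos
    have h8 : ∫ s in (0 : ℝ)..Real.pi, G.ext s = 0 := h7
    rw [h8] at hpos
    simp at hpos

end ArcFun

/-- The orbit of `x' = y, y' = -Q(x, y)` starting at `(0, y₀)` runs through `x > 0` and then meets
the `y`-axis at `(0, -y₁)`. -/
def HalfArc (Q : ℝ → ℝ → ℝ) (y₀ y₁ : ℝ) : Prop :=
  ∃ T > 0, ∃ x y : ℝ → ℝ,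
    (∀ t ∈ Icc 0 T, HasDerivAt x (y t) t ∧ HasDerivAt y (-Q (x t) (y t)) t) ∧
    x 0 = 0 ∧ y 0 = y₀ ∧ x T = 0 ∧ y T = -y₁ ∧ ∀ t ∈ Ioo 0 T, 0 < x t

/-- A curve in `x ≥ 0` following `x' = y, y' = -Q(x, y)` up to a positive time factor `τ`. -/
structure IsTimedArc (Q : ℝ → ℝ → ℝ) (x y : ℝ → ℝ) (τ : ArcFun) : Prop where
  pos_time : ∀ t, 0 < τ t
  left : x 0 = 0
  right : x Real.pi = 0
  pos : ∀ t ∈ Ioo 0 Real.pi, 0 < x t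
  deriv_fst : ∀ t : Icc (0 : ℝ) Real.pi, HasDerivAt x (τ t * y t) t
  deriv_snd : ∀ t : Icc (0 : ℝ) Real.pi, HasDerivAt y (-(τ t * Q (x t) (y t))) t

namespace ArcFun

lemma exists_inverse_prim (τ : ArcFun) (hτ : ∀ t, 0 < τ t) :
    ∃ e : ℝ ≃o ℝ, (∀ t, e t = τ.prim t) ∧
      ∀ s, HasDerivAt e.symm (τ.ext (e.symm s))⁻¹ s := by
  obtain ⟨t₀, -, ht₀⟩ := isCompact_univ.exists_isMinOn (s := (univ : Set (Icc (0 : ℝ) Real.pi)))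
    ⟨endpt, mem_univ _⟩ τ.continuous.continuousOn
  have hδ : ∀ t, τ t₀ ≤ τ.ext t := fun t => ht₀ (mem_univ _)
  have hpos : ∀ t, 0 < τ.ext t := fun t => hτ _
  have hmono : Monotone fun t => τ.prim t - τ t₀ * t := by
    have hd : ∀ t, HasDerivAt (fun t => τ.prim t - τ t₀ * t) (τ.ext t - τ t₀ * 1) t := fun t =>
      (τ.hasDerivAt_prim t).sub ((hasDerivAt_id t).const_mul _)
    refine monotone_of_deriv_nonneg (fun t => (hd t).differentiableAt) fun t => ?_
    rw [(hd t).deriv, mul_one]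
    linarith [hδ t]
  have hstrict : StrictMono τ.prim :=
    strictMono_of_deriv_pos fun t => by rw [(τ.hasDerivAt_prim t).deriv]; exact hpos t
  have htop : Filter.Tendsto τ.prim Filter.atTop Filter.atTop := by
    refine Filter.tendsto_atTop_mono' _ ?_ (Filter.tendsto_id.const_mul_atTop (hτ t₀))
    filter_upwards [Filter.eventually_ge_atTop (0 : ℝ)] with t ht
    have := hmono ht
    simp [prim_zero] at this
    simpa using this
  have hbot : Filter.Tendsto τ.prim Filter.atBot Filter.atBot := by
    refine Filter.tendsto_atBot_mono' _ ?_ (Filter.tendsto_id.const_mul_atBot (hτ t₀))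
    filter_upwards [Filter.eventually_le_atBot (0 : ℝ)] with t ht
    have := hmono ht
    simp [prim_zero] at this
    simpa using this
  have hsurj : Function.Surjective τ.prim := τ.continuous_prim.surjective htop hbot
  refine ⟨hstrict.orderIsoOfSurjective _ hsurj, fun t => rfl, fun s => ?_⟩
  set e := hstrict.orderIsoOfSurjective _ hsurj
  refine HasDerivAt.of_local_left_inverse (f := τ.prim) e.symm.continuous.continuousAt
    (τ.hasDerivAt_prim _) (hpos _).ne' (Filter.Eventually.of_forall fun z => ?_)
  exact e.apply_symm_apply z

end ArcFun

open ArcFun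

lemma IsTimedArc.halfArc {Q : ℝ → ℝ → ℝ} {x y : ℝ → ℝ} {τ : ArcFun} (h : IsTimedArc Q x y τ) :
    HalfArc Q (y 0) (-y Real.pi) := by
  obtain ⟨e, he, hd⟩ := τ.exists_inverse_prim h.pos_time
  have he0 : e 0 = 0 := by rw [he, prim_zero]
  have hs0 : e.symm 0 = 0 := by rw [← he0, e.symm_apply_apply, he0]
  have hsT : e.symm (e Real.pi) = Real.pi := e.symm_apply_apply _
  refine ⟨e Real.pi, ?_, fun s => x (e.symm s), fun s => y (e.symm s), ?_, ?_, ?_, ?_, ?_, ?_⟩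
  · rw [← he0]; exact e.strictMono Real.pi_pos
  · intro s hs
    have hmem : e.symm s ∈ Icc (0 : ℝ) Real.pi := by
      constructor
      · rw [← hs0]; exact e.symm.monotone hs.1
      · rw [← hsT]; exact e.symm.monotone hs.2
    have h1 := (h.deriv_fst ⟨_, hmem⟩).comp s (hd s)
    have h2 := (h.deriv_snd ⟨_, hmem⟩).comp s (hd s)
    have hne := (h.pos_time ⟨_, hmem⟩).ne'
    rw [ext_of_mem _ hmem] at h1 h2
    exact ⟨h1.congr_deriv (by field_simp), h2.congr_deriv (by field_simp)⟩
  · simp only [hs0, h.left]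
  · simp only [hs0]
  · simp only [hsT, h.right]
  · simp only [hsT, neg_neg]
  · intro s hs
    apply h.pos
    constructor
    · rw [← hs0]; exact e.symm.strictMono hs.1
    · rw [← hsT]; exact e.symm.strictMono hs.2

lemma ArcFun.IsPolarArc.exists_timedArc {M N ρ : ArcFun} (h : IsPolarArc M N ρ)
    {Q : ℝ → ℝ → ℝ}
    (hQ : ∀ t, M t * Q (ρ t * Real.sin t) (ρ t ^ 2 * Real.cos t) = ρ t ^ 3 * N t) :
    ∃ (x y : ℝ → ℝ) (τ : ArcFun), IsTimedArc Q x y τ ∧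
      (∀ t : Icc (0 : ℝ) Real.pi, x t = ρ t * Real.sin t ∧ y t = ρ t ^ 2 * Real.cos t) ∧
      y 0 = 1 ∧ y Real.pi = -ρ endpt ^ 2 := by
  set R : ℝ → ℝ := fun t => 1 + (polarField M N ρ).prim t with hR
  have hRρ : ∀ t : Icc (0 : ℝ) Real.pi, R t = ρ t := by
    intro t
    exact (congrArg (fun f : ArcFun => f t) h.eq).symm
  have hRd : ∀ t : Icc (0 : ℝ) Real.pi, HasDerivAt R (polarField M N ρ t) t := by
    intro t
    have := ((polarField M N ρ).hasDerivAt_prim t).const_add 1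
    rwa [ext_coe] at this
  have hval : ∀ t, polarField M N ρ t =
      ρ t * Real.cos t * (Real.sin t * M t - N t) * (polarDen M N t)⁻¹ := by
    intro t
    simp [polarField, inverse_apply h.pos_den, sinI_apply, cosI_apply]
  have hden : ∀ t, polarDen M N t = 2 * Real.cos t ^ 2 * M t + Real.sin t * N t := by
    intro t
    simp [polarDen, sinI_apply, cosI_apply, two_apply]
  have hR0 : R 0 = 1 := by simp [hR, prim_zero]
  let τ : ArcFun := ⟨fun t => M t * (2 * Real.cos t ^ 2 + Real.sin t ^ 2) /
    (ρ t * polarDen M N t), by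
      refine Continuous.div (by fun_prop) (by fun_prop) fun t =>
        (mul_pos (h.pos t) (h.pos_den t)).ne'⟩
  have hτ : ∀ t, τ t = M t * (2 * Real.cos t ^ 2 + Real.sin t ^ 2) / (ρ t * polarDen M N t) :=
    fun t => rfl
  refine ⟨fun t => R t * Real.sin t, fun t => R t ^ 2 * Real.cos t, τ, ⟨?_, ?_, ?_, ?_, ?_, ?_⟩,
    ?_, ?_, ?_⟩
  · intro t
    rw [hτ]
    have h1 := h.pos t
    have h2 := h.pos_mass t
    have h3 := h.pos_den t
    have h4 : 0 < 2 * Real.cos t ^ 2 + Real.sin t ^ 2 := by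
      nlinarith [Real.sin_sq_add_cos_sq (t : ℝ), sq_nonneg (Real.cos t)]
    positivity
  · simp
  · simp
  · intro t ht
    have := h.pos ⟨t, Ioo_subset_Icc_self ht⟩
    rw [← hRρ] at this
    exact mul_pos this (Real.sin_pos_of_mem_Ioo ht)
  · intro t
    refine ((hRd t).mul (Real.hasDerivAt_sin t)).congr_deriv ?_
    have h1 := (h.pos t).ne'
    have h3 := (h.pos_den t).ne'
    rw [hRρ, hval, hτ]
    field_simp
    rw [hden]; ring
  · intro t
    have hd := ((hRd t).pow 2).mul (Real.hasDerivAt_cos t)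
    refine hd.congr_deriv ?_
    have h1 := (h.pos t).ne'
    have h3 := (h.pos_den t).ne'
    have h5 : τ t * Q (R t * Real.sin t) (R t ^ 2 * Real.cos t) =
        (2 * Real.cos t ^ 2 + Real.sin t ^ 2) * ρ t ^ 2 * N t / polarDen M N t := by
      have hq := hQ t
      rw [hτ, hRρ]
      generalize Q (ρ t * Real.sin t) (ρ t ^ 2 * Real.cos t) = q at hq ⊢
      field_simp
      linear_combination (2 * Real.cos t ^ 2 + Real.sin t ^ 2) * hq
    rw [h5]
    simp only [Pi.pow_apply, hRρ, hval]
    push_cast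
    field_simp
    rw [hden]; ring
  · intro t
    simp only [hRρ, and_self]
  · simp [hR0]
  · have := hRρ endpt
    simp only [endpt] at this ⊢
    simp [this]

lemma eqOn_of_hasDerivAt_right {v : ℝ × ℝ → ℝ × ℝ} (hv : ContDiff ℝ 1 v) {f g : ℝ → ℝ × ℝ} {a b : ℝ}
    (hf : ∀ t ∈ Icc a b, HasDerivAt f (v (f t)) t) (hg : ∀ t ∈ Icc a b, HasDerivAt g (v (g t)) t)
    (h : f a = g a) : EqOn f g (Icc a b) := by
  have hfc : ContinuousOn f (Icc a b) := fun t ht => (hf t ht).continuousAt.continuousWithinAt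
  have hgc : ContinuousOn g (Icc a b) := fun t ht => (hg t ht).continuousAt.continuousWithinAt
  obtain ⟨r, hr⟩ := ((isCompact_Icc.image_of_continuousOn hfc).union
    (isCompact_Icc.image_of_continuousOn hgc)).isBounded.subset_closedBall (0 : ℝ × ℝ)
  obtain ⟨K, hK⟩ := hv.contDiffOn.exists_lipschitzOnWith one_ne_zero
    (convex_closedBall (0 : ℝ × ℝ) r) (isCompact_closedBall _ _)
  exact ODE_solution_unique_of_mem_Icc_right (v := fun _ => v)
    (s := fun _ => closedBall (0 : ℝ × ℝ) r) (fun t _ => hK) hfc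
    (fun t ht => (hf t (Ico_subset_Icc_self ht)).hasDerivWithinAt)
    (fun t ht => hr (Or.inl (mem_image_of_mem f (Ico_subset_Icc_self ht)))) hgc
    (fun t ht => (hg t (Ico_subset_Icc_self ht)).hasDerivWithinAt)
    (fun t ht => hr (Or.inr (mem_image_of_mem g (Ico_subset_Icc_self ht)))) h

lemma eqOn_of_hasDerivAt_left {v : ℝ × ℝ → ℝ × ℝ} (hv : ContDiff ℝ 1 v) {f g : ℝ → ℝ × ℝ} {a b : ℝ}
    (hf : ∀ t ∈ Icc a b, HasDerivAt f (v (f t)) t) (hg : ∀ t ∈ Icc a b, HasDerivAt g (v (g t)) t)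
    (h : f b = g b) : EqOn f g (Icc a b) := by
  have key : ∀ f : ℝ → ℝ × ℝ, (∀ t ∈ Icc a b, HasDerivAt f (v (f t)) t) →
      ∀ t ∈ Icc (-b) (-a), HasDerivAt (fun s => f (-s)) (-v (f (-t))) t := by
    intro f hf t ht
    have := (hf (-t) ⟨by linarith [ht.2], by linarith [ht.1]⟩).scomp t (hasDerivAt_neg t)
    exact this.congr_deriv (by simp)
  have := eqOn_of_hasDerivAt_right (v := fun z => -v z) hv.neg (key f hf) (key g hg)
    (by simpa using h)
  intro t ht
  have h2 := this (x := -t) ⟨by linarith [ht.2], by linarith [ht.1]⟩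
  simpa using h2

/-- The planar vector field of the system `x' = y, y' = -Q(x, y)`. -/
def lienardField (Q : ℝ → ℝ → ℝ) (z : ℝ × ℝ) : ℝ × ℝ := (z.2, -Q z.1 z.2)

/-- A solution, defined for all times, of `x' = y, y' = -Q(x, y)`. -/
def IsSol (Q : ℝ → ℝ → ℝ) (γ : ℝ → ℝ × ℝ) : Prop := ∀ t, HasDerivAt γ (lienardField Q (γ t)) t

lemma IsSol.continuous {Q : ℝ → ℝ → ℝ} {γ : ℝ → ℝ × ℝ} (h : IsSol Q γ) : Continuous γ :=
  continuous_iff_continuousAt.2 fun t => (h t).continuousAt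

lemma IsSol.shift {Q : ℝ → ℝ → ℝ} {γ : ℝ → ℝ × ℝ} (h : IsSol Q γ) (c : ℝ) :
    IsSol Q fun t => γ (t + c) := fun t => (h (t + c)).comp_add_const t c

lemma IsSol.eq_of_eq_zero {Q : ℝ → ℝ → ℝ} (hQ : ContDiff ℝ 1 (lienardField Q)) {γ δ : ℝ → ℝ × ℝ}
    (h : IsSol Q γ) (h' : IsSol Q δ) (h0 : γ 0 = δ 0) : γ = δ := by
  funext t
  rcases le_total 0 t with ht | ht
  · exact eqOn_of_hasDerivAt_right hQ (a := 0) (b := t) (fun s _ => h s) (fun s _ => h' s) h0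
      ⟨ht, le_rfl⟩
  · exact eqOn_of_hasDerivAt_left hQ (a := t) (b := 0) (fun s _ => h s) (fun s _ => h' s) h0
      ⟨le_rfl, ht⟩

lemma IsSol.range_subset {Q : ℝ → ℝ → ℝ} (hQ : ContDiff ℝ 1 (lienardField Q)) {γ δ : ℝ → ℝ × ℝ}
    (h : IsSol Q γ) (h' : IsSol Q δ) {a b : ℝ} (hab : γ a = δ b) : range γ ⊆ range δ := by
  have := IsSol.eq_of_eq_zero hQ (h.shift a) (h'.shift b) (by simpa using hab)
  rintro _ ⟨t, rfl⟩
  refine ⟨t - a + b, ?_⟩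
  have h2 := congrFun this (t - a)
  simpa using h2.symm

lemma IsSol.range_eq {Q : ℝ → ℝ → ℝ} (hQ : ContDiff ℝ 1 (lienardField Q)) {γ δ : ℝ → ℝ × ℝ}
    (h : IsSol Q γ) (h' : IsSol Q δ) {a b : ℝ} (hab : γ a = δ b) : range γ = range δ :=
  (h.range_subset hQ h' hab).antisymm (h'.range_subset hQ h hab.symm)

lemma IsSol.reflect {Q : ℝ → ℝ → ℝ} {γ : ℝ → ℝ × ℝ} (h : IsSol Q γ) :
    IsSol (fun x y => -Q (-x) y) fun t => (-(γ (-t)).1, (γ (-t)).2) := by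
  intro t
  have h1 := (h (-t)).scomp t (hasDerivAt_neg t)
  have h2 := (hasFDerivAt_fst (𝕜 := ℝ)).comp_hasDerivAt t h1
  have h3 := (hasFDerivAt_snd (𝕜 := ℝ)).comp_hasDerivAt t h1
  refine (h2.neg.prodMk h3).congr_deriv ?_
  simp [lienardField]

lemma HalfArc.unique {Q : ℝ → ℝ → ℝ} (hQ : ContDiff ℝ 1 (lienardField Q)) {y₀ y₁ y₂ : ℝ}
    (h₁ : HalfArc Q y₀ y₁) (h₂ : HalfArc Q y₀ y₂) : y₁ = y₂ := by
  wlog hle : h₁.choose ≤ h₂.choose generalizing y₁ y₂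
  · exact (this h₂ h₁ (le_of_not_ge hle)).symm
  obtain ⟨hT, x, y, hd, hx0, hy0, hxT, hyT, -⟩ := h₁.choose_spec
  obtain ⟨hT', x', y', hd', hx0', hy0', hxT', hyT', hpos'⟩ := h₂.choose_spec
  set T := h₁.choose
  set T' := h₂.choose
  have heq := eqOn_of_hasDerivAt_right hQ (f := fun t => (x t, y t)) (g := fun t => (x' t, y' t))
    (a := 0) (b := T) (fun t ht => (hd t ht).1.prodMk (hd t ht).2)
    (fun t ht => (hd' t ⟨ht.1, ht.2.trans hle⟩).1.prodMk (hd' t ⟨ht.1, ht.2.trans hle⟩).2)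
    (by simp [hx0, hy0, hx0', hy0'])
  have h := heq (x := T) ⟨hT.le, le_rfl⟩
  simp only [Prod.mk.injEq] at h
  rcases hle.lt_or_eq with hlt | heq
  · have := hpos' T ⟨hT, hlt⟩
    rw [← h.1, hxT] at this
    exact absurd this (lt_irrefl _)
  · have h2 := h.2
    rw [hyT, heq, hyT'] at h2
    exact neg_injective h2

lemma HalfArc.exists_after {Q : ℝ → ℝ → ℝ} (hQ : ContDiff ℝ 1 (lienardField Q)) {y₀ y₁ : ℝ}
    (h : HalfArc Q y₀ y₁) {γ : ℝ → ℝ × ℝ} (hγ : IsSol Q γ)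
    {t₀ : ℝ} (h0 : γ t₀ = (0, y₀)) : ∃ t, γ t = (0, -y₁) := by
  obtain ⟨T, hT, x, y, hd, hx0, hy0, hxT, hyT, -⟩ := h
  have heq := eqOn_of_hasDerivAt_right hQ (f := fun t => (x t, y t)) (g := fun t => γ (t + t₀))
    (a := 0) (b := T) (fun t ht => (hd t ht).1.prodMk (hd t ht).2)
    (fun t ht => hγ.shift t₀ t) (by simp [hx0, hy0, h0])
  refine ⟨T + t₀, ?_⟩
  have := heq (x := T) ⟨hT.le, le_rfl⟩
  simp only [hxT, hyT] at this
  exact this.symm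

lemma HalfArc.exists_before {Q : ℝ → ℝ → ℝ} (hQ : ContDiff ℝ 1 (lienardField Q)) {y₀ y₁ : ℝ}
    (h : HalfArc Q y₀ y₁) {γ : ℝ → ℝ × ℝ} (hγ : IsSol Q γ)
    {t₁ : ℝ} (h1 : γ t₁ = (0, -y₁)) : ∃ t, γ t = (0, y₀) := by
  obtain ⟨T, hT, x, y, hd, hx0, hy0, hxT, hyT, -⟩ := h
  have heq := eqOn_of_hasDerivAt_left hQ (f := fun t => (x t, y t))
    (g := fun t => γ (t + (t₁ - T)))
    (a := 0) (b := T) (fun t ht => (hd t ht).1.prodMk (hd t ht).2)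
    (fun t ht => hγ.shift _ t) (by simp [hxT, hyT, h1])
  refine ⟨0 + (t₁ - T), ?_⟩
  have := heq (x := 0) ⟨le_rfl, hT.le⟩
  simp only [hx0, hy0] at this
  exact this.symm

lemma contDiff_reflect {Q : ℝ → ℝ → ℝ} (hQ : ContDiff ℝ 1 (lienardField Q)) :
    ContDiff ℝ 1 (lienardField fun x y => -Q (-x) y) := by
  have h1 : ContDiff ℝ 1 fun z : ℝ × ℝ => (-z.1, z.2) := contDiff_fst.neg.prodMk contDiff_snd
  have h2 := (hQ.comp h1).snd
  exact contDiff_snd.prodMk h2.neg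

/-- The parameter space `(a₁₁, a₀₂, a₃₀, a₂₁, a₁₂, a₀₃)`. -/
abbrev KuklesParam : Type := ℝ × ℝ × ℝ × ℝ × ℝ × ℝ

namespace KuklesParam

/-- The polynomial `Q` of the system `x' = y, y' = -Q(x, y)`. -/
def poly (p : KuklesParam) (x y : ℝ) : ℝ :=
  p.1 * x * y + p.2.1 * y ^ 2 + p.2.2.1 * x ^ 3 + p.2.2.2.1 * x ^ 2 * y +
    p.2.2.2.2.1 * x * y ^ 2 + p.2.2.2.2.2 * y ^ 3

/-- The parameters of the system after the rescaling `(x, y) ↦ (r x, r² y)`. -/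
def scale (r : ℝ) (p : KuklesParam) : KuklesParam :=
  (p.1, r * p.2.1, p.2.2.1, r * p.2.2.2.1, r ^ 2 * p.2.2.2.2.1, r ^ 3 * p.2.2.2.2.2)

/-- The parameters of the system after the reflection `(x, y, t) ↦ (-x, y, -t)`. -/
def reflect (p : KuklesParam) : KuklesParam :=
  (p.1, -p.2.1, p.2.2.1, -p.2.2.2.1, p.2.2.2.2.1, -p.2.2.2.2.2)

lemma scale_neg (r : ℝ) (p : KuklesParam) : scale (-r) p = scale r (reflect p) := by
  simp only [scale, reflect, Prod.mk.injEq, true_and]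
  exact ⟨by ring, by ring, by ring, by ring⟩

lemma poly_reflect (p : KuklesParam) : (fun x y => -p.poly (-x) y) = p.reflect.poly := by
  funext x y
  simp only [poly, reflect]; ring

lemma poly_scale (r : ℝ) (p : KuklesParam) (x y : ℝ) :
    r ^ 3 * (scale r p).poly x y = p.poly (r * x) (r ^ 2 * y) := by
  simp only [poly, scale]; ring

lemma contDiff_lienardField (p : KuklesParam) : ContDiff ℝ 1 (lienardField p.poly) := by
  unfold lienardField poly; fun_prop

lemma contDiff_scale {n : WithTop ℕ∞} :
    ContDiff ℝ n fun z : KuklesParam × ℝ => scale z.2 z.1 := by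
  unfold scale; fun_prop

end KuklesParam

open KuklesParam

lemma HalfArc.rescale {Q Q' : ℝ → ℝ → ℝ} {r : ℝ} (hr : 0 < r)
    (hQ : ∀ x y, r ^ 3 * Q' x y = Q (r * x) (r ^ 2 * y)) {y₀ y₁ : ℝ} (h : HalfArc Q' y₀ y₁) :
    HalfArc Q (r ^ 2 * y₀) (r ^ 2 * y₁) := by
  obtain ⟨T, hT, x, y, hd, hx0, hy0, hxT, hyT, hpos⟩ := h
  have hmul : ∀ t, HasDerivAt (fun s => r * s) r t := fun t => by
    simpa using (hasDerivAt_id t).const_mul r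
  have hT' : r * (T / r) = T := mul_div_cancel₀ T hr.ne'
  refine ⟨T / r, by positivity, fun t => r * x (r * t), fun t => r ^ 2 * y (r * t), ?_,
    by simp [hx0], by simp [hy0], by simp [hT', hxT], by simp [hT', hyT], ?_⟩
  · intro t ht
    have hmem : r * t ∈ Icc 0 T :=
      ⟨mul_nonneg hr.le ht.1, by rw [← hT']; exact mul_le_mul_of_nonneg_left ht.2 hr.le⟩
    obtain ⟨h1, h2⟩ := hd _ hmem
    refine ⟨((h1.comp t (hmul t)).const_mul r).congr_deriv (by ring),
      ((h2.comp t (hmul t)).const_mul (r ^ 2)).congr_deriv ?_⟩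
    rw [← hQ]; ring
  · intro t ht
    exact mul_pos hr (hpos _ ⟨mul_pos hr ht.1, by
      rw [← hT']; exact mul_lt_mul_of_pos_left ht.2 hr⟩)

/-- Evaluation at the endpoint `π`. -/
noncomputable def ArcFun.evalEndpt : ArcFun →L[ℝ] ℝ := ContinuousMap.evalCLM ℝ ArcFun.endpt

open Topology in
/-- The half-return map along orbits starting at `(0, 1)`, near the quasi-homogeneous system. -/
lemma exists_halfReturn {a g : ℝ} (hag : a ^ 2 < 8 * g) {n : ℕ} (hn : n ≠ 0) :
    ∃ H : KuklesParam → ℝ, ContDiffAt ℝ n H (a, 0, g, 0, 0, 0) ∧ 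
      ∀ᶠ p : KuklesParam in 𝓝 (a, 0, g, 0, 0, 0), 0 < H p ∧ HalfArc p.poly 1 (H p) := by
  let M : KuklesParam × ArcFun → ArcFun := fun _ => 1
  let N : KuklesParam × ArcFun → ArcFun := fun z =>
    z.1.1 • (ArcFun.sinI * ArcFun.cosI) + z.1.2.1 • (z.2 * ArcFun.cosI ^ 2) +
      z.1.2.2.1 • ArcFun.sinI ^ 3 + z.1.2.2.2.1 • (z.2 * (ArcFun.sinI ^ 2 * ArcFun.cosI)) +
      z.1.2.2.2.2.1 • (z.2 ^ 2 * (ArcFun.sinI * ArcFun.cosI ^ 2)) +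
      z.1.2.2.2.2.2 • (z.2 ^ 3 * ArcFun.cosI ^ 3)
  have hN : ContDiff ℝ n N := by fun_prop
  obtain ⟨sol, hc, hev, -⟩ := ArcFun.exists_flow (p₀ := ((a, 0, g, 0, 0, 0) : KuklesParam)) hag
    (n := n) (by exact_mod_cast hn) (contDiff_const : ContDiff ℝ n M) hN (fun _ => rfl)
    (fun ρ => by simp [N])
  have hsol : ContDiffAt ℝ n (fun p => sol p ArcFun.endpt) (a, 0, g, 0, 0, 0) :=
    (ArcFun.evalEndpt.contDiff.contDiffAt (x := sol (a, 0, g, 0, 0, 0))).comp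
      (f := sol) (a, 0, g, 0, 0, 0) hc
  refine ⟨fun p => sol p ArcFun.endpt ^ 2, hsol.pow 2, ?_⟩
  filter_upwards [hev] with p hp
  refine ⟨pow_pos (hp.pos _) 2, ?_⟩
  obtain ⟨x, y, τ, hxy, -, hy0, hyT⟩ := hp.exists_timedArc (Q := p.poly) fun t => by
    simp [N, poly, ArcFun.sinI_apply, ArcFun.cosI_apply]; ring
  have := hxy.halfArc
  rwa [hy0, hyT, neg_neg] at this

open Topology in
/-- The two half-return maps `r² ↦ r² H(p, r)` and `r² ↦ r² H(p, -r)` of the systems near `a`. -/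
lemma exists_halfReturn_scaled {a : KuklesParam} (ha : a.1 ^ 2 < 8 * a.2.2.1) {n : ℕ}
    (hn : n ≠ 0) :
    ∃ H : KuklesParam × ℝ → ℝ, ContDiffAt ℝ n H (a, 0) ∧
      ∀ᶠ z : KuklesParam × ℝ in 𝓝 (a, 0), 0 < H z ∧ 0 < H (z.1, -z.2) ∧
        (0 < z.2 → HalfArc z.1.poly (z.2 ^ 2) (z.2 ^ 2 * H z) ∧
          HalfArc z.1.reflect.poly (z.2 ^ 2) (z.2 ^ 2 * H (z.1, -z.2))) := by
  obtain ⟨H, hH, hev⟩ := exists_halfReturn ha hn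
  have hs0 : scale 0 a = (a.1, 0, a.2.2.1, 0, 0, 0) := by simp [scale]
  have hc : ContinuousAt (fun z : KuklesParam × ℝ => scale z.2 z.1) (a, 0) :=
    (contDiff_scale (n := 0)).continuous.continuousAt
  have hc' : ContinuousAt (fun z : KuklesParam × ℝ => scale (-z.2) z.1) (a, 0) := by
    have : Continuous fun z : KuklesParam × ℝ => scale (-z.2) z.1 := by
      unfold scale; fun_prop
    exact this.continuousAt
  refine ⟨fun z => H (scale z.2 z.1), ?_, ?_⟩
  · refine ContDiffAt.comp (a, (0 : ℝ)) ?_ contDiff_scale.contDiffAt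
    simpa only [hs0] using hH
  · have e1 := hc.eventually (by simpa only [hs0] using hev)
    have e2 := hc'.eventually (by simpa only [neg_zero, hs0] using hev)
    filter_upwards [e1, e2] with z h1 h2
    refine ⟨h1.1, h2.1, fun hz => ⟨?_, ?_⟩⟩
    · simpa using h1.2.rescale hz (poly_scale _ _)
    · have h3 := h2.2
      rw [scale_neg] at h3
      have := h3.rescale hz (poly_scale _ _)
      simpa [scale_neg] using this

/-- Iterated Rolle: if the `k`-th derivative has no zero on an interval, the function has at most
`k` zeros there. -/
lemma card_zeros_le {I : Set ℝ} (hI : I.OrdConnected) (k : ℕ) (f : ℕ → ℝ → ℝ)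
    (hf : ∀ i < k, ∀ r ∈ I, HasDerivAt (f i) (f (i + 1) r) r) (hk : ∀ r ∈ I, f k r ≠ 0) :
    ∀ s : Finset ℝ, (∀ r ∈ s, r ∈ I ∧ f 0 r = 0) → s.card ≤ k := by
  induction k generalizing f with
  | zero =>
    intro s hs
    rw [Nat.le_zero, Finset.card_eq_zero, Finset.eq_empty_iff_forall_notMem]
    exact fun r hr => hk r (hs r hr).1 (hs r hr).2
  | succ k ih =>
    intro s hs
    have ih' := ih (fun i => f (i + 1)) (fun i hi => hf (i + 1) (by omega)) hk
    have hfin : {r | r ∈ I ∧ f 1 r = 0}.Finite := by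
      by_contra hinf
      obtain ⟨t, ht, hcard⟩ := Set.Infinite.exists_subset_card_eq hinf (k + 1)
      have := ih' t fun r hr => ht hr
      omega
    have h1 : hfin.toFinset.card ≤ k := ih' _ fun r hr => hfin.mem_toFinset.1 hr
    have h2 : s.card ≤ hfin.toFinset.card + 1 := by
      apply Finset.card_le_of_interleaved
      intro x hx y hy hxy _
      have hsub : Icc x y ⊆ I := hI.out (hs x hx).1 (hs y hy).1
      have hd : ∀ r ∈ Icc x y, HasDerivAt (f 0) (f 1 r) r := fun r hr =>
        hf 0 (Nat.succ_pos k) r (hsub hr)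
      obtain ⟨z, hz, hz'⟩ := exists_hasDerivAt_eq_zero hxy
        (fun r hr => (hd r hr).continuousAt.continuousWithinAt)
        ((hs x hx).2.trans (hs y hy).2.symm) (fun r hr => hd r (Ioo_subset_Icc_self hr))
      exact ⟨z, hfin.mem_toFinset.2 ⟨hsub (Ioo_subset_Icc_self hz), hz'⟩, hz.1, hz.2⟩
    omega

lemma abs_le_of_derivs_vanish {δ η : ℝ} (k : ℕ) (f : ℕ → ℝ → ℝ)
    (hf : ∀ i < k, ∀ r ∈ Icc 0 δ, HasDerivAt (f i) (f (i + 1) r) r)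
    (h0 : ∀ i < k, f i 0 = 0) (hη : ∀ r ∈ Icc 0 δ, |f k r| ≤ η) :
    ∀ r ∈ Icc 0 δ, |f 0 r| ≤ η * r ^ k := by
  induction k generalizing f with
  | zero => simpa using hη
  | succ k ih =>
    intro r hr
    have ih' := ih (fun i => f (i + 1)) (fun i hi => hf (i + 1) (by omega))
      (fun i hi => h0 (i + 1) (by omega)) hη
    have hη0 : 0 ≤ η := (abs_nonneg _).trans (hη r hr)
    have hsub : ∀ s ∈ Icc 0 r, s ∈ Icc 0 δ := fun s hs => ⟨hs.1, hs.2.trans hr.2⟩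
    have := norm_image_sub_le_of_norm_deriv_le_segment' (f := f 0) (f' := f 1) (C := η * r ^ k)
      (fun s hs => (hf 0 (Nat.succ_pos k) s (hsub s hs)).hasDerivWithinAt)
      (fun s hs => (ih' s (hsub s (Ico_subset_Icc_self hs))).trans
        (mul_le_mul_of_nonneg_left (pow_le_pow_left₀ hs.1 hs.2.le k) hη0)) r ⟨hr.1, le_rfl⟩
    rw [h0 0 (Nat.succ_pos k), sub_zero, sub_zero, Real.norm_eq_abs] at this
    rw [pow_succ, ← mul_assoc]; exact this

section
variable {P : Type*} [NormedAddCommGroup P] [NormedSpace ℝ P]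

/-- The `k`-th partial derivative with respect to the last variable. -/
noncomputable def partialDeriv (q : P × ℝ → ℝ) : ℕ → P × ℝ → ℝ
  | 0 => q
  | k + 1 => fun z => fderiv ℝ (partialDeriv q k) z (0, 1)

lemma contDiffAt_partialDeriv {q : P × ℝ → ℝ} {z : P × ℝ} (k : ℕ) {m : ℕ}
    (hq : ContDiffAt ℝ (m + k : ℕ) q z) : ContDiffAt ℝ m (partialDeriv q k) z := by
  induction k generalizing m with
  | zero => simpa [partialDeriv] using hq
  | succ k ih =>
    have h1 : ContDiffAt ℝ (m + 1 : ℕ) (partialDeriv q k) z :=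
      ih (by rwa [show m + 1 + k = m + (k + 1) by omega])
    have h2 : ContDiffAt ℝ m (fderiv ℝ (partialDeriv q k)) z := h1.fderiv_right (by norm_cast)
    exact h2.clm_apply contDiffAt_const

lemma hasDerivAt_partialDeriv {q : P × ℝ → ℝ} {p : P} {r : ℝ} {k : ℕ}
    (h : DifferentiableAt ℝ (partialDeriv q k) (p, r)) :
    HasDerivAt (fun s => partialDeriv q k (p, s)) (partialDeriv q (k + 1) (p, r)) r :=
  h.hasFDerivAt.comp_hasDerivAt r ((hasDerivAt_const r p).prodMk (hasDerivAt_id r))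

open Topology in
lemma eventually_hasDerivAt_partialDeriv {q : P × ℝ → ℝ} {z : P × ℝ} {k n : ℕ} (hk : k < n)
    (hq : ContDiffAt ℝ n q z) :
    ∀ᶠ y : P × ℝ in 𝓝 z, 
      HasDerivAt (fun s => partialDeriv q k (y.1, s)) (partialDeriv q (k + 1) y) y.2 := by
  have h1 : ContDiffAt ℝ (1 : ℕ) (partialDeriv q k) z :=
    contDiffAt_partialDeriv k (hq.of_le (by norm_cast; omega))
  filter_upwards [h1.eventually (by simp)] with y hy
  exact hasDerivAt_partialDeriv (hy.differentiableAt (by simp))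

open Topology in
/-- A function odd in its last variable and not flat of order `w ≤ 7` has at most three small
positive zeros. -/
lemma exists_card_zeros_le_three {q : P × ℝ → ℝ} {a : P} {w : ℕ} (hw : w ≤ 7)
    (hq : ContDiffAt ℝ (w + 1 : ℕ) q (a, 0)) (hodd : ∀ p r, q (p, -r) = -q (p, r))
    {c : ℝ} (hc : 0 < c) (hflat : ∀ᶠ r in 𝓝[>] (0 : ℝ), c * r ^ w ≤ |q (a, r)|) :
    ∃ ε > 0, ∀ᶠ p in 𝓝 a, ∀ s : Finset ℝ, (∀ r ∈ s, 0 < r ∧ r < ε ∧ q (p, r) = 0) →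
      s.card ≤ 3 := by
  have hder : ∀ᶠ y : P × ℝ in 𝓝 (a, 0), ∀ i < w,
      HasDerivAt (fun s => partialDeriv q i (y.1, s)) (partialDeriv q (i + 1) y) y.2 :=
    (Filter.eventually_all_finite (Set.finite_lt_nat w)).2 fun i hi =>
      eventually_hasDerivAt_partialDeriv (Nat.lt_succ_of_lt hi) hq
  have hcont : ∀ k ≤ w, ContinuousAt (partialDeriv q k) (a, 0) := fun k hk =>
    (contDiffAt_partialDeriv (m := 0) k (hq.of_le (by norm_cast; omega))).continuousAt
  obtain ⟨k, hkw, hk⟩ : ∃ k ≤ w, partialDeriv q k (a, 0) ≠ 0 := by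
    by_contra! hall
    have hline : Filter.Tendsto (fun r : ℝ => (a, r)) (𝓝 0) (𝓝 (a, 0)) :=
      Continuous.tendsto (f := fun r : ℝ => (a, r)) (by fun_prop) 0
    have h1 : ∀ᶠ y in 𝓝 ((a, 0) : P × ℝ), |partialDeriv q w y| < c / 2 := by
      have := (hcont w le_rfl).abs.eventually_lt_const (u := c / 2)
        (by simp only [hall w le_rfl, abs_zero]; positivity)
      exact this
    obtain ⟨δ, hδ, hball⟩ := Metric.eventually_nhds_iff_ball.1 (hline.eventually (hder.and h1))
    have hmem : ∀ r ∈ Icc 0 (δ / 2), r ∈ ball (0 : ℝ) δ := by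
      intro r hr
      rw [mem_ball_zero_iff, Real.norm_eq_abs, abs_of_nonneg hr.1]
      linarith [hr.2]
    have hbound := abs_le_of_derivs_vanish (δ := δ / 2) (η := c / 2) w
      (fun i r => partialDeriv q i (a, r)) (fun i hi r hr => (hball r (hmem r hr)).1 i hi)
      (fun i hi => hall i hi.le) (fun r hr => (hball r (hmem r hr)).2.le)
    have h2 : ∀ᶠ r in 𝓝[>] (0 : ℝ), r ∈ Ioo 0 (δ / 2) := Ioo_mem_nhdsGT (by positivity)
    obtain ⟨r, hr1, hr2⟩ := (hflat.and h2).exists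
    have h3 := hbound r (Ioo_subset_Icc_self hr2)
    have h4 : 0 < r ^ w := pow_pos hr2.1 w
    have h5 : partialDeriv q 0 (a, r) = q (a, r) := rfl
    rw [h5] at h3
    nlinarith
  have hne : ∀ᶠ y in 𝓝 ((a, 0) : P × ℝ), partialDeriv q k y ≠ 0 := (hcont k hkw).eventually_ne hk
  rw [nhds_prod_eq] at hder hne
  obtain ⟨A, hA, B, hB, hAB⟩ := Filter.eventually_prod_iff.1 (hder.and hne)
  obtain ⟨ε, hε, hball⟩ := Metric.eventually_nhds_iff_ball.1 hB
  refine ⟨ε, hε, hA.mono fun p hp s hs => ?_⟩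
  have hI : ∀ r ∈ Ioo (-ε) ε, r ∈ ball (0 : ℝ) ε := by
    intro r hr
    rw [mem_ball_zero_iff, Real.norm_eq_abs, abs_lt]; exact hr
  have hcard := card_zeros_le (I := Ioo (-ε) ε) ordConnected_Ioo k
    (fun i r => partialDeriv q i (p, r))
    (fun i hi r hr => (hAB hp (hball r (hI r hr))).1 i (hi.trans_le hkw))
    (fun r hr => (hAB hp (hball r (hI r hr))).2)
  have h0 : q (p, 0) = 0 := by
    have := hodd p 0
    rw [neg_zero] at this; linarith
  have hneg : (s.image fun r => -r).card = s.card := Finset.card_image_of_injective _ neg_injective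
  have hdisj : Disjoint s (s.image fun r => -r) := by
    rw [Finset.disjoint_left]
    intro r hr hr'
    obtain ⟨r₁, hr₁, rfl⟩ := Finset.mem_image.1 hr'
    linarith [(hs _ hr).1, (hs _ hr₁).1]
  have hzero : (0 : ℝ) ∉ s ∪ s.image fun r => -r := by
    rw [Finset.mem_union]
    rintro (h | h)
    · exact lt_irrefl _ (hs _ h).1
    · obtain ⟨r', hr', h⟩ := Finset.mem_image.1 h
      linarith [(hs _ hr').1]
  have := hcard (insert 0 (s ∪ s.image fun r => -r)) (by
    intro r hr
    rcases Finset.mem_insert.1 hr with rfl | hr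
    · exact ⟨⟨by linarith, hε⟩, h0⟩
    rcases Finset.mem_union.1 hr with hr | hr
    · obtain ⟨h1, h2, h3⟩ := hs r hr
      exact ⟨⟨by linarith, h2⟩, h3⟩
    · obtain ⟨r', hr', rfl⟩ := Finset.mem_image.1 hr
      obtain ⟨h1, h2, h3⟩ := hs r' hr'
      refine ⟨⟨by linarith, by linarith⟩, ?_⟩
      show q (p, -r') = 0
      rw [hodd, h3, neg_zero])
  rw [Finset.card_insert_of_notMem hzero, Finset.card_union_of_disjoint hdisj, hneg] at this
  omega

end

/-- A nonconstant periodic orbit of `x' = y, y' = -Q(x, y)`. -/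
def IsPeriodicOrbit (Q : ℝ → ℝ → ℝ) (Γ : Set (ℝ × ℝ)) : Prop :=
  ∃ (γ : ℝ → ℝ × ℝ) (T : ℝ), 0 < T ∧ IsSol Q γ ∧ Function.Periodic γ T ∧ (∃ t, γ t ≠ γ 0) ∧
    Γ = range γ

lemma IsSol.hasDerivAt_fst {Q : ℝ → ℝ → ℝ} {γ : ℝ → ℝ × ℝ} (h : IsSol Q γ) (t : ℝ) :
    HasDerivAt (fun s => (γ s).1) (γ t).2 t :=
  HasFDerivAt.comp_hasDerivAt t (hasFDerivAt_fst (𝕜 := ℝ) (E := ℝ) (F := ℝ) (p := γ t)) (h t)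

lemma IsSol.hasDerivAt_snd {Q : ℝ → ℝ → ℝ} {γ : ℝ → ℝ × ℝ} (h : IsSol Q γ) (t : ℝ) :
    HasDerivAt (fun s => (γ s).2) (-Q (γ t).1 (γ t).2) t :=
  HasFDerivAt.comp_hasDerivAt t (hasFDerivAt_snd (𝕜 := ℝ) (E := ℝ) (F := ℝ) (p := γ t)) (h t)

lemma IsSol.eq_zero {Q : ℝ → ℝ → ℝ} (hQ : ContDiff ℝ 1 (lienardField Q)) (hQ0 : Q 0 0 = 0)
    {γ : ℝ → ℝ × ℝ} (h : IsSol Q γ) {t₀ : ℝ} (h0 : γ t₀ = 0) (t : ℝ) : γ t = 0 := by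
  have hz : IsSol Q fun _ => 0 := fun t => by
    have : lienardField Q 0 = 0 := by simp [lienardField, hQ0]
    rw [this]; exact hasDerivAt_const _ _
  have := h.range_subset hQ hz (a := t₀) (b := 0) h0
  obtain ⟨s, hs⟩ := this (mem_range_self t)
  exact hs.symm

/-- At a maximum of `x` along a solution the vector field cannot point to larger `x`. -/
lemma IsSol.nonneg_of_isMax {Q : ℝ → ℝ → ℝ} {γ : ℝ → ℝ × ℝ} (h : IsSol Q γ) {t₀ : ℝ}
    (hmax : ∀ t, (γ t).1 ≤ (γ t₀).1) : (γ t₀).2 = 0 ∧ 0 ≤ Q (γ t₀).1 0 := by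
  have hloc : IsLocalMax (fun s => (γ s).1) t₀ := Filter.Eventually.of_forall hmax
  have hy : (γ t₀).2 = 0 := hloc.hasDerivAt_eq_zero (h.hasDerivAt_fst t₀)
  refine ⟨hy, ?_⟩
  by_contra! hneg
  have hd1 : deriv (fun s => (γ s).1) = fun s => (γ s).2 :=
    funext fun s => (h.hasDerivAt_fst s).deriv
  have hd2 := h.hasDerivAt_snd t₀
  have hmin := isLocalMin_of_deriv_deriv_pos (f := fun s => (γ s).1) (x₀ := t₀)
    (by rw [hd1, hd2.deriv, hy]; linarith) (by rw [hd1]; exact hy)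
    (h.hasDerivAt_fst t₀).continuousAt
  have hconst : (fun s => (γ s).1) =ᶠ[nhds t₀] fun _ => (γ t₀).1 := by
    filter_upwards [hmin] with s hs using le_antisymm (hmax s) hs
  have hzero : (fun s => (γ s).2) =ᶠ[nhds t₀] fun _ => 0 := by
    have := hconst.deriv
    rw [hd1] at this
    simpa using this
  have h3 := hd2.unique ((hasDerivAt_const t₀ (0 : ℝ)).congr_of_eventuallyEq hzero)
  rw [hy] at h3
  linarith

lemma IsSol.exists_upcrossing {Q : ℝ → ℝ → ℝ} (hQ : ContDiff ℝ 1 (lienardField Q))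
    (hQp : ∀ x, 0 < x → 0 < Q x 0) (hQn : ∀ x < 0, Q x 0 < 0) (hQ0 : Q 0 0 = 0) {γ : ℝ → ℝ × ℝ}
    {T : ℝ} (h : IsSol Q γ) (hT : 0 < T) (hper : Function.Periodic γ T) (hne : ∃ t, γ t ≠ γ 0) :
    ∃ t, (γ t).1 = 0 ∧ 0 ≤ (γ t).2 := by
  have hnz : ∀ t, γ t ≠ 0 := by
    intro t ht
    obtain ⟨s, hs⟩ := hne
    rw [h.eq_zero hQ hQ0 ht s, h.eq_zero hQ hQ0 ht 0] at hs
    exact hs rfl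
  have hx : Continuous fun t => (γ t).1 := h.continuous.fst
  have hred : ∀ t, ∃ s ∈ Icc 0 T, (γ t).1 = (γ s).1 := by
    intro t
    obtain ⟨s, hs, hst⟩ := hper.exists_mem_Ico₀ hT t
    exact ⟨s, Ico_subset_Icc_self hs, by rw [hst]⟩
  obtain ⟨tM, -, hM⟩ := isCompact_Icc.exists_isMaxOn (nonempty_Icc.2 hT.le) hx.continuousOn
  obtain ⟨tm, -, hm⟩ := isCompact_Icc.exists_isMinOn (nonempty_Icc.2 hT.le) hx.continuousOn
  have hM' : ∀ t, (γ t).1 ≤ (γ tM).1 := fun t => by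
    obtain ⟨s, hs, hst⟩ := hred t
    rw [hst]; exact hM hs
  have hm' : ∀ t, (γ tm).1 ≤ (γ t).1 := fun t => by
    obtain ⟨s, hs, hst⟩ := hred t
    rw [hst]; exact hm hs
  have hposM : 0 < (γ tM).1 := by
    obtain ⟨hy, hq⟩ := h.nonneg_of_isMax hM'
    rcases lt_trichotomy (γ tM).1 0 with hlt | heq | hgt
    · exact absurd (hQn _ hlt) (not_lt.2 hq)
    · exact absurd (Prod.ext heq hy) (hnz tM)
    · exact hgt
  have hnegm : (γ tm).1 < 0 := by
    have h2 := h.reflect.nonneg_of_isMax (t₀ := -tm) (fun t => by simpa using hm' (-t))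
    simp only [neg_neg] at h2
    obtain ⟨hy, hq⟩ := h2
    rcases lt_trichotomy (γ tm).1 0 with hlt | heq | hgt
    · exact hlt
    · exact absurd (Prod.ext heq hy) (hnz tm)
    · have := hQp _ hgt
      linarith
  by_contra! hall
  obtain ⟨k, hk⟩ := exists_nat_gt ((tm - tM) / T)
  have hk' : tm ≤ tM + k * T := by
    rw [div_lt_iff₀ hT] at hk; linarith
  have := image_le_of_deriv_right_lt_deriv_boundary (f := fun t => (γ t).1)
    (f' := fun t => (γ t).2) (B := fun _ => 0) (B' := fun _ => 0) (a := tm) (b := tM + k * T)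
    hx.continuousOn (fun t _ => (h.hasDerivAt_fst t).hasDerivWithinAt) hnegm.le
    (fun t => hasDerivAt_const _ _) (fun t _ ht => hall t ht) ⟨hk', le_rfl⟩
  rw [show γ (tM + k * T) = γ tM from hper.nat_mul k tM] at this
  exact absurd hposM (not_lt.2 this)

lemma IsSol.exists_smaller_crossing {Q : ℝ → ℝ → ℝ} (hQ : ContDiff ℝ 1 (lienardField Q))
    {φ : ℝ → ℝ} {r b : ℝ} (hr : 0 < r) (hφ : ContinuousOn φ (Icc 0 r)) (hφ0 : φ 0 = 0)
    (hleft : ∀ s ∈ Ioc 0 r, HalfArc (fun x y => -Q (-x) y) (s ^ 2) (φ s))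
    (hright : HalfArc Q (r ^ 2) b) (hb : 0 < b) (hbr : b < φ r) {γ : ℝ → ℝ × ℝ}
    (h : IsSol Q γ) {t₀ : ℝ} (h0 : γ t₀ = (0, r ^ 2)) :
    ∃ t s, 0 < s ∧ s < r ∧ γ t = (0, s ^ 2) := by
  obtain ⟨t₁, ht₁⟩ := hright.exists_after hQ h h0
  obtain ⟨s, hs, hsb⟩ := intermediate_value_Ioo hr.le hφ (show b ∈ Ioo (φ 0) (φ r) from
    ⟨by rwa [hφ0], hbr⟩)
  have h2 := hleft s (Ioo_subset_Ioc_self hs)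
  rw [hsb] at h2
  obtain ⟨t, ht⟩ := h2.exists_before (contDiff_reflect hQ) h.reflect (t₁ := -t₁) (by simp [ht₁])
  simp only [Prod.mk.injEq, neg_eq_zero] at ht
  exact ⟨-t, s, hs.1, hs.2, Prod.ext ht.1 ht.2⟩

namespace KuklesParam

/-- The two half-return maps of the system differ at a finite order at most `7`. -/
def NonFlat (a : KuklesParam) : Prop :=
  ∃ w ≤ 7, ∃ c > 0, ∀ᶠ r in nhdsWithin (0 : ℝ) (Ioi 0), ∀ y₁ y₂,
    HalfArc a.poly (r ^ 2) (r ^ 2 * y₁) → HalfArc a.reflect.poly (r ^ 2) (r ^ 2 * y₂) →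
      c * r ^ w ≤ |y₁ - y₂|

lemma reflect_reflect (p : KuklesParam) : p.reflect.reflect = p := by
  simp [reflect]

open Topology in
lemma exists_card_orbits_le_three {a : KuklesParam} (ha : a.1 ^ 2 < 8 * a.2.2.1)
    (hflat : a.NonFlat) :
    ∃ δ > 0, ∀ᶠ p : KuklesParam in 𝓝 a, ∀ S : Finset (Set (ℝ × ℝ)),
      (∀ Γ ∈ S, IsPeriodicOrbit p.poly Γ ∧ ∀ z ∈ Γ, |z.2| < δ) → S.card ≤ 3 := by
  obtain ⟨w, hw, c, hc, hflat⟩ := hflat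
  obtain ⟨H, hH, hev⟩ := exists_halfReturn_scaled ha (Nat.succ_ne_zero w)
  set q : KuklesParam × ℝ → ℝ := fun z => H z - H (z.1, -z.2) with hq
  have hneg : ContDiffAt ℝ (w + 1 : ℕ) (fun z : KuklesParam × ℝ => H (z.1, -z.2)) (a, 0) := by
    refine ContDiffAt.comp (a, (0 : ℝ)) (f := fun z : KuklesParam × ℝ => (z.1, -z.2)) ?_
      (by fun_prop)
    simpa using hH
  have hline : Filter.Tendsto (fun r : ℝ => (a, r)) (𝓝[>] 0) (𝓝 (a, 0)) :=
    (Continuous.tendsto (f := fun r : ℝ => (a, r)) (by fun_prop) 0).mono_left nhdsWithin_le_nhds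
  obtain ⟨ε, hε, hcount⟩ := exists_card_zeros_le_three (q := q) hw (hH.sub hneg)
    (fun p r => by simp [hq]) hc (by
      filter_upwards [hflat, hline.eventually hev, self_mem_nhdsWithin] with r h1 h2 h3
      exact h1 _ _ (h2.2.2 h3).1 (h2.2.2 h3).2)
  have hcont : ∀ᶠ z : KuklesParam × ℝ in 𝓝 (a, 0),
      ContinuousAt H z ∧ ContinuousAt (fun z : KuklesParam × ℝ => H (z.1, -z.2)) z :=
    ((hH.eventually (by simp)).mono fun z hz => hz.continuousAt).and
      ((hneg.eventually (by simp)).mono fun z hz => hz.continuousAt)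
  have hall := hev.and hcont
  rw [nhds_prod_eq] at hall
  obtain ⟨A, hA, B, hB, hAB⟩ := Filter.eventually_prod_iff.1 hall
  obtain ⟨ε', hε', hball⟩ := Metric.eventually_nhds_iff_ball.1 hB
  have hg : 0 < a.2.2.1 := by nlinarith [sq_nonneg a.1]
  have hgp : ∀ᶠ p : KuklesParam in 𝓝 a, 0 < p.2.2.1 :=
    (Continuous.tendsto (f := fun p : KuklesParam => p.2.2.1) (by fun_prop)
      a).eventually_const_lt hg
  refine ⟨min ε ε' ^ 2, by positivity, ?_⟩
  filter_upwards [hcount, hA, hgp] with p hcnt hp hgp S hS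
  have hQ := contDiff_lienardField p
  have key : ∀ Γ ∈ S, ∃ r, 0 < r ∧ r < ε ∧ q (p, r) = 0 ∧ (0, r ^ 2) ∈ Γ := by
    intro Γ hΓ
    obtain ⟨⟨γ, T, hT, hγ, hper, hne, rfl⟩, hsmall⟩ := hS Γ hΓ
    have hQ0 : p.poly 0 0 = 0 := by simp [poly]
    obtain ⟨t₁, ht₁, ht₁'⟩ := hγ.exists_upcrossing hQ
      (fun x hx => by simp only [poly]; ring_nf; positivity)
      (fun x hx => by
        simp only [poly]; ring_nf
        have : x ^ 3 < 0 := by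
          have := mul_pos_of_neg_of_neg hx hx
          nlinarith
        nlinarith) hQ0 hT hper hne
    have hK : IsCompact {t ∈ Icc 0 T | (γ t).1 = 0 ∧ 0 ≤ (γ t).2} := by
      refine isCompact_Icc.inter_right ?_
      exact (isClosed_eq hγ.continuous.fst continuous_const).inter
        (isClosed_le continuous_const hγ.continuous.snd)
    have hred : ∀ t, (γ t).1 = 0 → 0 ≤ (γ t).2 →
        ∃ s ∈ {t ∈ Icc 0 T | (γ t).1 = 0 ∧ 0 ≤ (γ t).2}, γ t = γ s := by
      intro t h1 h2
      obtain ⟨s, hs, hst⟩ := hper.exists_mem_Ico₀ hT t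
      exact ⟨s, ⟨Ico_subset_Icc_self hs, by rwa [← hst], by rwa [← hst]⟩, hst⟩
    obtain ⟨s₁, hs₁, -⟩ := hred t₁ ht₁ ht₁'
    obtain ⟨t₀, ht₀, hmin⟩ := hK.exists_isMinOn ⟨s₁, hs₁⟩
      (f := fun t => (γ t).2) hγ.continuous.snd.continuousOn
    have hmin' : ∀ t, (γ t).1 = 0 → 0 ≤ (γ t).2 → (γ t₀).2 ≤ (γ t).2 := by
      intro t h1 h2
      obtain ⟨s, hs, hst⟩ := hred t h1 h2
      rw [hst]; exact hmin hs
    have hy0 : 0 < (γ t₀).2 := by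
      rcases ht₀.2.2.lt_or_eq with h | h
      · exact h
      · exfalso
        have h0 : γ t₀ = 0 := Prod.ext ht₀.2.1 h.symm
        obtain ⟨t, ht⟩ := hne
        rw [hγ.eq_zero hQ hQ0 h0 t, hγ.eq_zero hQ hQ0 h0 0] at ht
        exact ht rfl
    set r := Real.sqrt (γ t₀).2 with hr
    have hr0 : 0 < r := Real.sqrt_pos.2 hy0
    have hr2 : r ^ 2 = (γ t₀).2 := Real.sq_sqrt hy0.le
    have hγ0 : γ t₀ = (0, r ^ 2) := Prod.ext ht₀.2.1 hr2.symm
    have hrsmall : r < min ε ε' := by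
      have := hsmall _ (mem_range_self t₀)
      rw [abs_of_pos hy0, ← hr2] at this
      exact lt_of_pow_lt_pow_left₀ 2 (by positivity) this
    have hnot : ∀ t s, 0 < s → s < r → γ t ≠ (0, s ^ 2) := by
      intro t s hs hsr ht
      have := hmin' t (by rw [ht]) (by rw [ht]; positivity)
      rw [ht, ← hr2] at this
      exact absurd (pow_lt_pow_left₀ hsr hs.le two_ne_zero) (not_lt.2 this)
    have hgood : ∀ s ∈ Icc 0 r, _ := fun s hs => hAB hp (hball s (by
      rw [mem_ball_zero_iff, Real.norm_eq_abs, abs_of_nonneg hs.1]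
      exact hs.2.trans_lt (hrsmall.trans_le (min_le_right _ _))))
    have hpr := hgood r ⟨hr0.le, le_rfl⟩
    have hpair : Continuous fun s : ℝ => (p, s) := by fun_prop
    refine ⟨r, hr0, hrsmall.trans_le (min_le_left _ _), ?_, ⟨t₀, hγ0⟩⟩
    rcases lt_trichotomy (H (p, r)) (H (p, -r)) with hlt | heq | hgt
    · exfalso
      obtain ⟨t, s, h1, h2, h3⟩ := hγ.exists_smaller_crossing hQ (b := r ^ 2 * H (p, r))
        (φ := fun s => s ^ 2 * H (p, -s)) hr0
        (fun s hs => ((continuousAt_id.pow 2).mul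
          ((hgood s hs).2.2.comp (f := fun s : ℝ => (p, s))
            hpair.continuousAt)).continuousWithinAt) (by simp)
        (fun s hs => by
          rw [poly_reflect]; exact ((hgood s (Ioc_subset_Icc_self hs)).1.2.2 hs.1).2)
        (hpr.1.2.2 hr0).1 (mul_pos (by positivity) hpr.1.1)
        (mul_lt_mul_of_pos_left hlt (by positivity)) hγ0
      exact hnot t s h1 h2 h3
    · simp [hq, heq]
    · exfalso
      have hγ' : IsSol p.reflect.poly fun t => (-(γ (-t)).1, (γ (-t)).2) := by
        rw [← poly_reflect]; exact hγ.reflect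
      obtain ⟨t, s, h1, h2, h3⟩ := hγ'.exists_smaller_crossing (contDiff_lienardField _)
        (b := r ^ 2 * H (p, -r)) (φ := fun s => s ^ 2 * H (p, s)) hr0
        (fun s hs => ((continuousAt_id.pow 2).mul
          ((hgood s hs).2.1.comp (f := fun s : ℝ => (p, s))
            hpair.continuousAt)).continuousWithinAt) (by simp)
        (fun s hs => by
          rw [poly_reflect, reflect_reflect]
          exact ((hgood s (Ioc_subset_Icc_self hs)).1.2.2 hs.1).1)
        (hpr.1.2.2 hr0).2 (mul_pos (by positivity) hpr.1.2.1)
        (mul_lt_mul_of_pos_left hgt (by positivity)) (t₀ := -t₀) (by simp [hγ0])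
      refine hnot (-t) s h1 h2 ?_
      simp only [Prod.mk.injEq, neg_eq_zero] at h3
      exact Prod.ext h3.1 h3.2
  choose! ρ hρ0 hρε hρq hρmem using key
  have hinj : Set.InjOn ρ S := by
    intro Γ hΓ Γ' hΓ' heq
    have h1 := hρmem Γ hΓ
    have h2 := hρmem Γ' hΓ'
    rw [← heq] at h2
    obtain ⟨γ, T, hT, hγ, -, -, rfl⟩ := (hS Γ hΓ).1
    obtain ⟨γ', T', hT', hγ', -, -, rfl⟩ := (hS Γ' hΓ').1
    obtain ⟨t, ht⟩ := h1
    obtain ⟨t', ht'⟩ := h2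
    exact hγ.range_eq hQ hγ' (ht.trans ht'.symm)
  rw [← Finset.card_image_of_injOn hinj]
  refine hcnt _ fun r hr => ?_
  obtain ⟨Γ, hΓ, rfl⟩ := Finset.mem_image.1 hr
  exact ⟨hρ0 Γ hΓ, hρε Γ hΓ, hρq Γ hΓ⟩

end KuklesParam

open Polynomial in
/-- The data of a change of variables `x = s χ(s)`, `y = Y / (m(s) + ψ(s) Y)` for the system with
parameters `param`, which turns it into `s' = Y`, `Y' = -field(s, Y)` up to a time change. -/
structure Chart where
  param : KuklesParam
  χ : ℝ[X]
  m : ℝ[X]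
  ψ : ℝ[X]

namespace Chart

open Polynomial in
/-- The derivative of the first component of the change of variables. -/
noncomputable def dx (c : Chart) : ℝ[X] := c.χ + X * derivative c.χ

open Polynomial in
/-- The coefficient of `s ^ 3` in the field. -/
noncomputable def cubic (c : Chart) : ℝ[X] := c.dx * c.χ ^ 3 * c.m ^ 2

open Polynomial in
/-- The coefficient of `s * Y` in the field. -/
noncomputable def mixed (c : Chart) : ℝ[X] :=
  c.dx * c.m * (C c.param.1 * c.χ + C c.param.2.2.2.1 * X * c.χ ^ 2 + 3 * X ^ 2 * c.χ ^ 3 * c.ψ)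

open Polynomial in
/-- The coefficient of `Y ^ 2` in the field multiplied by `m(s) m(-s)`. -/
noncomputable def quad (c : Chart) : ℝ[X] :=
  c.m.comp (-X) * (c.m * c.dx * (3 * X ^ 3 * c.χ ^ 3 * c.ψ ^ 2 +
    2 * (C c.param.1 * X * c.χ + C c.param.2.2.2.1 * X ^ 2 * c.χ ^ 2) * c.ψ +
    C c.param.2.1 + C c.param.2.2.2.2.1 * X * c.χ) - derivative c.m)

open Polynomial in
/-- The coefficient of `Y ^ 3` in the field multiplied by `m(s) m(-s)`. -/
noncomputable def cube (c : Chart) : ℝ[X] :=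
  c.m.comp (-X) * (c.dx * (X ^ 3 * c.χ ^ 3 * c.ψ ^ 3 +
    (C c.param.1 * X * c.χ + C c.param.2.2.2.1 * X ^ 2 * c.χ ^ 2) * c.ψ ^ 2 +
    (C c.param.2.1 + C c.param.2.2.2.2.1 * X * c.χ) * c.ψ + C c.param.2.2.2.2.2) -
    derivative c.ψ)

open Polynomial in
/-- The even multiplier `m(s) m(-s)`. -/
noncomputable def mass (c : Chart) : ℝ[X] := c.m * c.m.comp (-X)

/-- The field `s' = Y`, `Y' = -field(s, Y)` in the new variables. -/
noncomputable def field (c : Chart) (s Y : ℝ) : ℝ :=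
  s ^ 3 * c.cubic.eval s + s * c.mixed.eval s * Y +
    (c.quad.eval s * Y ^ 2 + c.cube.eval s * Y ^ 3) / c.mass.eval s

open Polynomial in
/-- The chart for the reflected system. -/
noncomputable def reflect (c : Chart) : Chart :=
  ⟨c.param.reflect, c.χ.comp (-X), c.m.comp (-X), c.ψ.comp (-X)⟩

/-- The normalisations imposed on a chart. -/
structure IsNormalized (c : Chart) : Prop where
  lead : c.param.2.2.1 = 1
  χ_zero : c.χ.eval 0 = 1
  m_zero : c.m.eval 0 = 1
  ψ_zero : c.ψ.eval 0 = 0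

lemma IsNormalized.reflect {c : Chart} (h : c.IsNormalized) : c.reflect.IsNormalized :=
  ⟨h.lead, by simp [Chart.reflect, h.χ_zero], by simp [Chart.reflect, h.m_zero],
    by simp [Chart.reflect, h.ψ_zero]⟩

lemma dx_reflect (c : Chart) (s : ℝ) : c.reflect.dx.eval s = c.dx.eval (-s) := by
  simp [dx, Chart.reflect, Polynomial.derivative_comp]

lemma mass_reflect (c : Chart) (s : ℝ) : c.reflect.mass.eval s = c.mass.eval s := by
  simp [mass, Chart.reflect]; ring

lemma cubic_reflect (c : Chart) (s : ℝ) : c.reflect.cubic.eval s = c.cubic.eval (-s) := by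
  simp only [cubic, Polynomial.eval_mul, dx_reflect]
  simp [Chart.reflect]

lemma mixed_reflect (c : Chart) (s : ℝ) : c.reflect.mixed.eval s = c.mixed.eval (-s) := by
  simp only [mixed, Polynomial.eval_mul, dx_reflect]
  simp [Chart.reflect, KuklesParam.reflect]

lemma quad_reflect (c : Chart) (s : ℝ) : c.reflect.quad.eval s = -c.quad.eval (-s) := by
  simp only [quad, Polynomial.eval_mul, Polynomial.eval_sub, dx_reflect]
  simp [Chart.reflect, KuklesParam.reflect, Polynomial.derivative_comp]
  ring

lemma cube_reflect (c : Chart) (s : ℝ) : c.reflect.cube.eval s = -c.cube.eval (-s) := by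
  simp only [cube, Polynomial.eval_mul, Polynomial.eval_sub, dx_reflect]
  simp [Chart.reflect, KuklesParam.reflect, Polynomial.derivative_comp]
  ring

/-- The change of variables intertwines the two fields. -/
lemma field_identity {c : Chart} (hc : c.IsNormalized) {s Y : ℝ} (hm : c.mass.eval s ≠ 0)
    (hD : c.m.eval s + c.ψ.eval s * Y ≠ 0) :
    c.m.eval s * c.field s Y + c.m.derivative.eval s * Y ^ 2 + c.ψ.derivative.eval s * Y ^ 3 =
      c.dx.eval s * (c.m.eval s + c.ψ.eval s * Y) ^ 3 *
        c.param.poly (s * c.χ.eval s) (Y / (c.m.eval s + c.ψ.eval s * Y)) := by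
  have hmass : c.mass.eval s = c.m.eval s * c.m.eval (-s) := by simp [mass]
  rw [hmass] at hm
  have h1 : c.m.eval s ≠ 0 := left_ne_zero_of_mul hm
  have h2 : c.m.eval (-s) ≠ 0 := right_ne_zero_of_mul hm
  simp only [field, KuklesParam.poly, hc.lead, hmass, cubic, mixed, quad, cube]
  simp only [Polynomial.eval_mul, Polynomial.eval_add, Polynomial.eval_pow, Polynomial.eval_C,
    Polynomial.eval_X, Polynomial.eval_sub, Polynomial.eval_comp, Polynomial.eval_neg,
    Polynomial.eval_ofNat]
  field_simp
  ring

lemma hasDerivAt_first (c : Chart) (s : ℝ) :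
    HasDerivAt (fun s => s * c.χ.eval s) (c.dx.eval s) s := by
  refine ((hasDerivAt_id s).mul (c.χ.hasDerivAt s)).congr_deriv ?_
  simp [dx]

lemma halfArc {c : Chart} (hc : c.IsNormalized) {r : ℝ} (hr : 0 < r) {x y : ℝ → ℝ} {τ : ArcFun}
    (h : IsTimedArc (fun x y => c.field (r * x) (r ^ 2 * y) / r ^ 3) x y τ)
    (hmass : ∀ t : Icc (0 : ℝ) Real.pi, c.mass.eval (r * x t) ≠ 0)
    (hdx : ∀ t : Icc (0 : ℝ) Real.pi, 0 < c.dx.eval (r * x t))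
    (hχ : ∀ t : Icc (0 : ℝ) Real.pi, 0 < c.χ.eval (r * x t))
    (hden : ∀ t : Icc (0 : ℝ) Real.pi,
      0 < c.m.eval (r * x t) + c.ψ.eval (r * x t) * (r ^ 2 * y t)) :
    HalfArc c.param.poly (r ^ 2 * y 0) (r ^ 2 * -y Real.pi) := by
  have hxc : Continuous fun t : Icc (0 : ℝ) Real.pi => x t := continuous_iff_continuousAt.2 fun t =>
    ContinuousAt.comp (g := x) (h.deriv_fst t).continuousAt continuous_subtype_val.continuousAt
  have hyc : Continuous fun t : Icc (0 : ℝ) Real.pi => y t := continuous_iff_continuousAt.2 fun t =>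
    ContinuousAt.comp (g := y) (h.deriv_snd t).continuousAt continuous_subtype_val.continuousAt
  have hp : ∀ p : Polynomial ℝ, Continuous fun t : Icc (0 : ℝ) Real.pi => p.eval (r * x t) :=
    fun p => p.continuous.comp (hxc.const_mul r)
  let σ : ArcFun := ⟨fun t => τ t * c.dx.eval (r * x t) *
    (c.m.eval (r * x t) + c.ψ.eval (r * x t) * (r ^ 2 * y t)) / r,
    (((τ.continuous.mul (hp _)).mul ((hp _).add ((hp _).mul (hyc.const_mul _)))).div_const r)⟩
  have hσ : ∀ t, σ t = τ t * c.dx.eval (r * x t) *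
    (c.m.eval (r * x t) + c.ψ.eval (r * x t) * (r ^ 2 * y t)) / r := fun t => rfl
  have hs : ∀ t : Icc (0 : ℝ) Real.pi, HasDerivAt (fun t => r * x t) (r * (τ t * y t)) t :=
    fun t => (h.deriv_fst t).const_mul r
  have key : IsTimedArc c.param.poly (fun t => r * x t * c.χ.eval (r * x t))
      (fun t => r ^ 2 * y t / (c.m.eval (r * x t) + c.ψ.eval (r * x t) * (r ^ 2 * y t))) σ := by
    refine ⟨fun t => ?_, by simp [h.left], by simp [h.right], fun t ht => ?_, fun t => ?_,
      fun t => ?_⟩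
    · rw [hσ]
      have h1 := h.pos_time t
      have h2 := hdx t
      have h3 := hden t
      positivity
    · exact mul_pos (mul_pos hr (h.pos t ht)) (hχ ⟨t, Ioo_subset_Icc_self ht⟩)
    · refine ((c.hasDerivAt_first _).comp (t : ℝ) (hs t)).congr_deriv ?_
      have h3 := (hden t).ne'
      rw [hσ]
      generalize c.m.eval _ + _ = D at *
      field_simp
    · have h3 := (hden t).ne'
      have hd := ((h.deriv_snd t).const_mul (r ^ 2)).div
        (((c.m.hasDerivAt _).comp (t : ℝ) (hs t)).add
          (((c.ψ.hasDerivAt _).comp (t : ℝ) (hs t)).mul ((h.deriv_snd t).const_mul (r ^ 2)))) h3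
      refine hd.congr_deriv ?_
      have hid := field_identity hc (hmass t) h3
      simp only [Pi.add_apply, Pi.mul_apply, Function.comp_apply]
      rw [hσ]
      generalize c.param.poly _ _ = P at hid ⊢
      generalize c.field _ _ = F at hid ⊢
      generalize c.dx.eval _ = ξ' at *
      generalize c.m.eval _ = m at *
      generalize c.ψ.eval _ = p at *
      rw [div_eq_iff (pow_ne_zero 2 h3)]
      field_simp
      linear_combination (-τ t) * hid
  have := key.halfArc
  simpa [h.left, h.right, hc.m_zero, hc.ψ_zero] using this

end Chart

lemma Polynomial.eval_eq_contract (p : Polynomial ℝ) (s : ℝ) :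
    p.eval s = (p.contract 2).eval (s ^ 2) + s * (p.divX.contract 2).eval (s ^ 2) := by
  have h : p = expand ℝ 2 (p.contract 2) + X * expand ℝ 2 (p.divX.contract 2) := by
    ext n
    obtain ⟨k, rfl | rfl⟩ := n.even_or_odd'
    · rcases k with _ | k
      · simp [coeff_expand, coeff_contract]
      · rw [coeff_add, show 2 * (k + 1) = 2 * k + 1 + 1 by ring, coeff_X_mul,
          coeff_expand two_pos, coeff_expand two_pos, if_pos (by omega), if_neg (by omega),
          coeff_contract two_ne_zero, add_zero]
        congr 1; omega
    · rw [coeff_add, coeff_X_mul, coeff_expand two_pos, coeff_expand two_pos, if_neg (by omega),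
        if_pos (by omega), coeff_contract two_ne_zero, coeff_divX, zero_add]
      congr 1; omega
  conv_lhs => rw [h]
  simp [expand_eval]

lemma Polynomial.exists_even_split {p : Polynomial ℝ} {k : ℕ} (h : ∀ i < k, p.coeff (2 * i) = 0) :
    ∃ e o : Polynomial ℝ, e.eval 0 = p.coeff (2 * k) ∧ o.eval 0 = p.coeff 1 ∧
      ∀ s, p.eval s = s ^ (2 * k) * e.eval (s ^ 2) + s * o.eval (s ^ 2) := by
  have hd : X ^ k ∣ p.contract 2 := X_pow_dvd_iff.2 fun i hi => by
    rw [coeff_contract two_ne_zero, mul_comm, h i hi]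
  obtain ⟨e, he⟩ := hd
  refine ⟨e, p.divX.contract 2, ?_, ?_, fun s => ?_⟩
  · have := congrArg (fun q => q.coeff k) he
    simp only [coeff_contract two_ne_zero] at this
    rw [show X ^ k * e = e * X ^ k by ring] at this
    rw [mul_comm, this, ← coeff_zero_eq_eval_zero]
    simpa using (coeff_mul_X_pow e k 0).symm
  · rw [← coeff_zero_eq_eval_zero, coeff_contract two_ne_zero, coeff_divX]
  · rw [eval_eq_contract p s, he]
    simp [← pow_mul]

lemma Polynomial.exists_odd_split {p : Polynomial ℝ} {k : ℕ}
    (h : ∀ i < k, p.coeff (2 * i + 1) = 0) :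
    ∃ e o : Polynomial ℝ, e.eval 0 = p.coeff (2 * k + 1) ∧ o.eval 0 = p.coeff 0 ∧
      ∀ s, p.eval s = o.eval (s ^ 2) + s ^ (2 * k + 1) * e.eval (s ^ 2) := by
  obtain ⟨e, o, he, -, h3⟩ := exists_even_split (p := p.divX) (k := k) fun i hi => by
    rw [coeff_divX, h i hi]
  refine ⟨e, p.contract 2, by rw [he, coeff_divX], ?_, fun s => ?_⟩
  · rw [← coeff_zero_eq_eval_zero, coeff_contract two_ne_zero, zero_mul]
  · have h1 : (p.divX.contract 2).eval (s ^ 2) = s ^ (2 * k) * e.eval (s ^ 2) := by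
      have hs := p.divX.eval_eq_contract
      have heven : ∀ s : ℝ, p.divX.eval s + p.divX.eval (-s) =
          2 * (p.divX.contract 2).eval (s ^ 2) := fun s => by rw [hs s, hs (-s), neg_sq]; ring
      have := heven s
      rw [h3 s, h3 (-s), neg_sq, (even_two_mul k).neg_pow] at this
      linarith
    rw [eval_eq_contract, h1]; ring

namespace Chart

/-- The field of `c` has odd part given by `o` and even part, of weight `2 v + 1`, given by
`σ • ε`. -/
structure IsSplit (c : Chart) (v : ℕ) (σ : ℝ) (o ε : Fin 4 → Polynomial ℝ) : Prop where
  cubic_eq : ∀ s, c.cubic.eval s = (o 0).eval (s ^ 2) + σ * (s ^ (2 * v + 3) * (ε 0).eval (s ^ 2))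
  mixed_eq : ∀ s, c.mixed.eval s = (o 1).eval (s ^ 2) + σ * (s ^ (2 * v + 1) * (ε 1).eval (s ^ 2))
  quad_eq : ∀ s, c.quad.eval s =
    s * (o 2).eval (s ^ 2) + σ * (s ^ (2 * v + 2) * (ε 2).eval (s ^ 2))
  cube_eq : ∀ s, c.cube.eval s = s * (o 3).eval (s ^ 2) + σ * (s ^ (2 * v) * (ε 3).eval (s ^ 2))

lemma IsSplit.reflect {c : Chart} {v : ℕ} {σ : ℝ} {o ε : Fin 4 → Polynomial ℝ}
    (h : c.IsSplit v σ o ε) : c.reflect.IsSplit v (-σ) o ε where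
  cubic_eq s := by
    rw [cubic_reflect, h.cubic_eq, neg_sq, pow_add, pow_add, (even_two_mul v).neg_pow]; ring
  mixed_eq s := by
    rw [mixed_reflect, h.mixed_eq, neg_sq, pow_add, pow_add, (even_two_mul v).neg_pow]; ring
  quad_eq s := by
    rw [quad_reflect, h.quad_eq, neg_sq, pow_add, pow_add, (even_two_mul v).neg_pow]; ring
  cube_eq s := by rw [cube_reflect, h.cube_eq, neg_sq, (even_two_mul v).neg_pow]; ring

/-- The even part of the field of the chart `c` vanishes up to weight `2 v - 1`, and has a nonzero
`s ^ (2 v + 2) * Y` term. -/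
structure HasWeight (c : Chart) (v : ℕ) : Prop where
  cubic_zero : ∀ i ≤ v, c.cubic.coeff (2 * i + 1) = 0
  mixed_zero : ∀ i < v, c.mixed.coeff (2 * i + 1) = 0
  quad_zero : ∀ i ≤ v, c.quad.coeff (2 * i) = 0
  cube_zero : ∀ i < v, c.cube.coeff (2 * i) = 0
  mixed_ne : c.mixed.coeff (2 * v + 1) ≠ 0

lemma HasWeight.exists_split {c : Chart} (hc : c.IsNormalized) {v : ℕ} (h : c.HasWeight v) :
    ∃ o ε, c.IsSplit v 1 o ε ∧ (o 0).eval 0 = 1 ∧ (o 1).eval 0 = c.param.1 ∧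
      (ε 1).eval 0 ≠ 0 := by
  obtain ⟨e0, o0, -, h0, h0'⟩ := Polynomial.exists_odd_split (k := v + 1)
    fun i hi => h.cubic_zero i (Nat.le_of_lt_succ hi)
  obtain ⟨e1, o1, h1, h1o, h1'⟩ := Polynomial.exists_odd_split h.mixed_zero
  obtain ⟨e2, o2, -, -, h2'⟩ := Polynomial.exists_even_split (k := v + 1)
    fun i hi => h.quad_zero i (Nat.le_of_lt_succ hi)
  obtain ⟨e3, o3, -, -, h3'⟩ := Polynomial.exists_even_split h.cube_zero
  have hdx : c.dx.eval 0 = 1 := by simp [dx, hc.χ_zero]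
  refine ⟨![o0, o1, o2, o3], ![e0, e1, e2, e3], ⟨?_, ?_, ?_, ?_⟩, ?_, ?_, ?_⟩
  · intro s; rw [h0']; simp [mul_add]
  · intro s; rw [h1']; simp
  · intro s; rw [h2']; simp [mul_add, add_comm]
  · intro s; rw [h3']; simp [add_comm]
  · simp [h0, Polynomial.coeff_zero_eq_eval_zero, cubic, hdx, hc.χ_zero, hc.m_zero]
  · simp [h1o, Polynomial.coeff_zero_eq_eval_zero, mixed, hdx, hc.χ_zero, hc.m_zero]
  · simpa [h1] using h.mixed_ne

end Chart

namespace Chart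

open ArcFun

lemma mass_eval (c : Chart) (s : ℝ) : c.mass.eval s = (c.mass.contract 2).eval (s ^ 2) := by
  have heven : c.mass.eval s = c.mass.eval (-s) := by simp [mass]; ring
  have h1 := c.mass.eval_eq_contract s
  have h2 := c.mass.eval_eq_contract (-s)
  rw [neg_sq] at h2
  linarith

/-- The argument `(r ρ sin)²` at which even functions are evaluated along the arc. -/
noncomputable def arg (z : (ℝ × ℝ) × ArcFun) : ArcFun := (z.1.1 • (z.2 * sinI)) ^ 2

/-- The even multiplier along the arc. -/
noncomputable def polarMass (c : Chart) (z : (ℝ × ℝ) × ArcFun) : ArcFun :=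
  Polynomial.aeval (arg z) (c.mass.contract 2)

/-- The field along the arc, multiplied by the even multiplier, where the parameter `z.1.2` stands
for `± r ^ (2 v + 1)`. -/
noncomputable def polarForce (c : Chart) (v : ℕ) (o ε : Fin 4 → Polynomial ℝ)
    (z : (ℝ × ℝ) × ArcFun) : ArcFun :=
  c.polarMass z * (Polynomial.aeval (arg z) (o 0) * sinI ^ 3 +
      Polynomial.aeval (arg z) (o 1) * (sinI * cosI)) +
    z.1.1 ^ 2 • (z.2 ^ 2 * sinI * cosI ^ 2 * Polynomial.aeval (arg z) (o 2)) +
    z.1.1 ^ 4 • (z.2 ^ 4 * sinI * cosI ^ 3 * Polynomial.aeval (arg z) (o 3)) +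
    z.1.2 • (c.polarMass z * (z.2 * sinI) ^ (2 * v + 1) * (sinI * cosI) *
        Polynomial.aeval (arg z) (ε 1) +
      z.1.1 ^ 2 • (z.2 ^ 2 * (z.2 * sinI) ^ (2 * v) * (z.2 *
        (c.polarMass z * sinI ^ 6 * Polynomial.aeval (arg z) (ε 0) +
          sinI ^ 2 * cosI ^ 2 * Polynomial.aeval (arg z) (ε 2) +
          cosI ^ 3 * Polynomial.aeval (arg z) (ε 3)))))

lemma contDiff_aeval_arg {n : WithTop ℕ∞} (p : Polynomial ℝ) :
    ContDiff ℝ n fun z => Polynomial.aeval (arg z) p := by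
  simp only [Polynomial.aeval_eq_sum_range, arg]
  fun_prop

lemma contDiff_polarMass (c : Chart) {n : WithTop ℕ∞} : ContDiff ℝ n c.polarMass :=
  contDiff_aeval_arg _

lemma contDiff_polarForce (c : Chart) (v : ℕ) (o ε : Fin 4 → Polynomial ℝ) {n : WithTop ℕ∞} :
    ContDiff ℝ n (c.polarForce v o ε) := by
  have h := fun p => contDiff_aeval_arg (n := n) p
  have hm := c.contDiff_polarMass (n := n)
  unfold polarForce
  fun_prop

lemma aeval_arg_zero (θ : ℝ) (ρ : ArcFun) (p : Polynomial ℝ) :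
    Polynomial.aeval (arg (((0 : ℝ), θ), ρ)) p = p.eval 0 • (1 : ArcFun) := by
  simp [arg, Polynomial.aeval_def, Polynomial.eval₂_at_zero, Polynomial.coeff_zero_eq_eval_zero,
    Algebra.algebraMap_eq_smul_one]

lemma polarMass_zero {c : Chart} (hc : c.IsNormalized) (θ : ℝ) (ρ : ArcFun) :
    c.polarMass ((0, θ), ρ) = 1 := by
  have := c.mass_eval 0
  rw [zero_pow two_ne_zero] at this
  rw [polarMass, aeval_arg_zero, ← this]
  simp [mass, hc.m_zero]

lemma aeval_arg_apply (z : (ℝ × ℝ) × ArcFun) (p : Polynomial ℝ) (t) :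
    Polynomial.aeval (arg z) p t = p.eval ((z.1.1 * (z.2 t * Real.sin t)) ^ 2) :=
  Polynomial.aeval_continuousMap_apply p (arg z) t

lemma polarMass_apply (c : Chart) (z : (ℝ × ℝ) × ArcFun) (t) :
    c.polarMass z t = c.mass.eval (z.1.1 * (z.2 t * Real.sin t)) := by
  rw [mass_eval, polarMass, aeval_arg_apply]

lemma polarForce_apply {c : Chart} {v : ℕ} {σ : ℝ} {o ε : Fin 4 → Polynomial ℝ}
    (h : c.IsSplit v σ o ε) {r : ℝ} (hr : r ≠ 0) {ρ : ArcFun} {t : Icc (0 : ℝ) Real.pi}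
    (hm : c.polarMass ((r, σ * r ^ (2 * v + 1)), ρ) t ≠ 0) :
    c.polarMass ((r, σ * r ^ (2 * v + 1)), ρ) t *
        (c.field (r * (ρ t * Real.sin t)) (r ^ 2 * (ρ t ^ 2 * Real.cos t)) / r ^ 3) =
      ρ t ^ 3 * c.polarForce v o ε ((r, σ * r ^ (2 * v + 1)), ρ) t := by
  simp only [polarForce, ContinuousMap.add_apply, ContinuousMap.mul_apply, ContinuousMap.smul_apply,
    ContinuousMap.pow_apply, sinI_apply, cosI_apply, aeval_arg_apply, smul_eq_mul]
  rw [polarMass_apply] at hm ⊢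
  simp only at hm ⊢
  rw [field, h.cubic_eq, h.mixed_eq, h.quad_eq, h.cube_eq]
  generalize c.mass.eval _ = M at hm ⊢
  field_simp
  ring

lemma exists_small {c : Chart} (hc : c.IsNormalized) :
    ∃ δ > 0, ∀ s Y : ℝ, |s| < δ → |Y| < δ →
      0 < c.dx.eval s ∧ 0 < c.χ.eval s ∧ 0 < c.m.eval s + c.ψ.eval s * Y := by
  have hdx : 0 < c.dx.eval 0 := by simp [dx, hc.χ_zero]
  have hχ : 0 < c.χ.eval 0 := by simp [hc.χ_zero]
  have h1 := (c.dx.continuous.comp continuous_fst : Continuous fun z : ℝ × ℝ => c.dx.eval z.1)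
    |>.continuousAt (x := (0, 0)) |>.eventually (lt_mem_nhds hdx)
  have h2 := (c.χ.continuous.comp continuous_fst : Continuous fun z : ℝ × ℝ => c.χ.eval z.1)
    |>.continuousAt (x := (0, 0)) |>.eventually (lt_mem_nhds hχ)
  have h3 := (((c.m.continuous.comp continuous_fst).add
    ((c.ψ.continuous.comp continuous_fst).mul continuous_snd)) :
      Continuous fun z : ℝ × ℝ => c.m.eval z.1 + c.ψ.eval z.1 * z.2)
    |>.continuousAt (x := (0, 0)) |>.eventually (lt_mem_nhds (a := 0) (by simp [hc.m_zero]))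
  obtain ⟨δ, hδ, h⟩ := Metric.eventually_nhds_iff.1 (h1.and (h2.and h3))
  refine ⟨δ, hδ, fun s Y hs hY => h (y := (s, Y)) ?_⟩
  simpa [Prod.dist_eq] using ⟨hs, hY⟩

/-- Half arcs of the original system obtained from solutions of the quasi-polar equation. -/
lemma halfArc_of_isPolarArc {c : Chart} (hc : c.IsNormalized) {v : ℕ} {σ : ℝ}
    {o ε : Fin 4 → Polynomial ℝ} (h : c.IsSplit v σ o ε) {δ : ℝ}
    (hδ : ∀ s Y : ℝ, |s| < δ → |Y| < δ →
      0 < c.dx.eval s ∧ 0 < c.χ.eval s ∧ 0 < c.m.eval s + c.ψ.eval s * Y)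
    {r R : ℝ} (hr : 0 < r) (hrR : r * R < δ) (hrR' : r ^ 2 * R ^ 2 < δ) {ρ : ArcFun}
    (hρ : ∀ t, ρ t ≤ R)
    (hpolar : IsPolarArc (c.polarMass ((r, σ * r ^ (2 * v + 1)), ρ))
      (c.polarForce v o ε ((r, σ * r ^ (2 * v + 1)), ρ)) ρ) :
    HalfArc c.param.poly (r ^ 2) (r ^ 2 * ρ endpt ^ 2) := by
  obtain ⟨x, y, τ, hxy, hval, hy0, hyπ⟩ := hpolar.exists_timedArc
    (Q := fun x y => c.field (r * x) (r ^ 2 * y) / r ^ 3)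
    fun t => polarForce_apply h hr.ne' (hpolar.pos_mass t).ne'
  have hs : ∀ t : Icc (0 : ℝ) Real.pi, |r * x t| < δ := fun t => by
    have h1 := hpolar.pos t
    rw [(hval t).1, abs_mul, abs_mul, abs_of_pos hr, abs_of_pos h1]
    refine lt_of_le_of_lt (mul_le_mul_of_nonneg_left ?_ hr.le) hrR
    exact (mul_le_of_le_one_right h1.le (Real.abs_sin_le_one _)).trans (hρ t)
  have hY : ∀ t : Icc (0 : ℝ) Real.pi, |r ^ 2 * y t| < δ := fun t => by
    have h1 := hpolar.pos t
    rw [(hval t).2, abs_mul, abs_mul, abs_of_pos (pow_pos hr 2), abs_of_pos (pow_pos h1 2)]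
    refine lt_of_le_of_lt (mul_le_mul_of_nonneg_left ?_ (pow_pos hr 2).le) hrR'
    exact (mul_le_of_le_one_right (pow_pos h1 2).le (Real.abs_cos_le_one _)).trans
      (pow_le_pow_left₀ h1.le (hρ t) 2)
  have := Chart.halfArc hc hr hxy (fun t => ?_) (fun t => (hδ _ _ (hs t) (hY t)).1)
    (fun t => (hδ _ _ (hs t) (hY t)).2.1) fun t => (hδ _ _ (hs t) (hY t)).2.2
  · simpa [hy0, hyπ] using this
  · have := hpolar.pos_mass t
    rw [polarMass_apply] at this
    rw [(hval t).1]
    exact this.ne'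

end Chart

open Topology in
/-- A map with nonvanishing derivative in the direction of `θ` separates `(r, ± r ^ w)`. -/
lemma exists_le_abs_sub {G : ℝ × ℝ → ℝ} {L : ℝ × ℝ →L[ℝ] ℝ} (h : HasStrictFDerivAt G L 0)
    (hL : L (0, 1) ≠ 0) {w : ℕ} (hw : w ≠ 0) :
    ∃ c > 0, ∀ᶠ r in 𝓝[>] (0 : ℝ), c * r ^ w ≤ |G (r, r ^ w) - G (r, -r ^ w)| := by
  have hL' : 0 < |L (0, 1)| := abs_pos.2 hL
  refine ⟨|L (0, 1)|, hL', ?_⟩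
  have hlim : Filter.Tendsto (fun r : ℝ => ((r, r ^ w), (r, -r ^ w))) (𝓝[>] 0)
      (𝓝 ((0 : ℝ × ℝ), (0 : ℝ × ℝ))) := by
    have hc : Continuous fun r : ℝ => (((r, r ^ w), (r, -r ^ w)) : (ℝ × ℝ) × ℝ × ℝ) := by fun_prop
    have := hc.tendsto 0
    simp only [zero_pow hw, neg_zero] at this
    exact this.mono_left nhdsWithin_le_nhds
  filter_upwards [hlim.eventually (h.isLittleO.def (half_pos hL')), self_mem_nhdsWithin]
    with r h1 hr
  have hr : 0 < r := hr
  have hrw : 0 < r ^ w := pow_pos hr w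
  have hdiff : ((r, r ^ w) : ℝ × ℝ) - (r, -r ^ w) = (2 * r ^ w) • (0, 1) := by
    ext <;> simp; ring
  rw [hdiff, map_smul, norm_smul, smul_eq_mul] at h1
  simp only [Prod.norm_mk, norm_zero, norm_one, Real.norm_eq_abs, abs_mul, abs_of_pos hrw,
    abs_two] at h1
  rw [max_eq_right zero_le_one] at h1
  have h2 : |2 * r ^ w * L (0, 1)| = 2 * r ^ w * |L (0, 1)| := by
    rw [abs_mul, abs_of_pos (by positivity : 0 < 2 * r ^ w)]
  have h3 := abs_sub_abs_le_abs_sub (2 * r ^ w * L (0, 1)) (G (r, r ^ w) - G (r, -r ^ w))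
  rw [abs_sub_comm (2 * r ^ w * L (0, 1))] at h3
  nlinarith

open ArcFun in
lemma Chart.polarForce_zero {c : Chart} (hc : c.IsNormalized) (v : ℕ)
    (o ε : Fin 4 → Polynomial ℝ) (θ : ℝ) (ρ : ArcFun) :
    c.polarForce v o ε ((0, θ), ρ) =
      (o 1).eval 0 • (sinI * cosI) + (o 0).eval 0 • sinI ^ 3 +
        (θ * (ε 1).eval 0) • (ρ ^ (2 * v + 1) * sinI ^ (2 * v + 1 + 1) * cosI) := by
  ext t
  simp [polarForce, polarMass_zero hc, aeval_arg_zero]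
  ring

open Topology ArcFun in
/-- A chart in which the even part of the field has finite weight shows that the two half-return
maps do not agree to all orders. -/
lemma Chart.nonFlat {c : Chart} (hc : c.IsNormalized) (ha : c.param.1 ^ 2 < 8) {v : ℕ} (hv : v ≤ 3)
    (h : c.HasWeight v) : c.param.NonFlat := by
  obtain ⟨o, ε, hsplit, ho0, ho1, hε⟩ := h.exists_split hc
  set w := 2 * v + 1 with hw
  obtain ⟨sol, hsol, hev, hderiv⟩ := ArcFun.exists_flow (p₀ := (0 : ℝ × ℝ))
    (a := c.param.1) (g := 1)
    (by simpa using ha) (n := 1) one_ne_zero c.contDiff_polarMass (c.contDiff_polarForce v o ε)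
    (fun ρ => polarMass_zero hc 0 ρ) (fun ρ => by
      rw [← Prod.mk_zero_zero, polarForce_zero hc, ho0, ho1, zero_mul, zero_smul, add_zero])
  have hne : fderiv ℝ sol 0 (0, 1) endpt ≠ 0 := by
    refine hderiv (0, 1) ((ε 1).eval 0) w hε (fun s ρ => ?_) fun s ρ => ?_
    · simpa using polarMass_zero hc s ρ
    · have e : (0 : ℝ × ℝ) + s • (0, 1) = (0, s) := by simp
      rw [e, ← Prod.mk_zero_zero, polarForce_zero hc, polarForce_zero hc, zero_mul, zero_smul,
        add_zero]
  have hpos0 : 0 < sol 0 endpt := hev.self_of_nhds.pos _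
  set G : ℝ × ℝ → ℝ := fun p => sol p endpt ^ 2 with hG
  have hGd : HasStrictFDerivAt G
      ((2 * sol 0 endpt) • (ArcFun.evalEndpt.comp (fderiv ℝ sol 0))) 0 := by
    have h1 : HasStrictFDerivAt (fun p => sol p endpt) (ArcFun.evalEndpt.comp (fderiv ℝ sol 0)) 0 :=
      ArcFun.evalEndpt.hasStrictFDerivAt.comp (f := sol) 0 (hsol.hasStrictFDerivAt one_ne_zero)
    simpa using h1.pow 2
  obtain ⟨C, hC, hbound⟩ := exists_le_abs_sub hGd (w := w) (mul_ne_zero (by positivity) hne)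
    (by omega)
  refine ⟨w, by omega, C, hC, ?_⟩
  obtain ⟨δ₁, hδ₁, hsmall₁⟩ := exists_small hc
  obtain ⟨δ₂, hδ₂, hsmall₂⟩ := exists_small hc.reflect
  set R := ‖sol 0‖ + 1 with hR
  have hbdd : ∀ᶠ p in 𝓝 0, ∀ t, sol p t ≤ R := by
    have := hsol.continuousAt.norm.eventually (gt_mem_nhds (lt_add_one ‖sol 0‖))
    filter_upwards [this] with p hp t
    exact (le_abs_self _).trans (((sol p).norm_coe_le_norm t).trans hp.le)
  have hline : ∀ σ : ℝ, Filter.Tendsto (fun r : ℝ => (r, σ * r ^ w)) (𝓝[>] 0) (𝓝 0) := by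
    intro σ
    have hcont : Continuous fun r : ℝ => ((r, σ * r ^ w) : ℝ × ℝ) := by fun_prop
    have := hcont.tendsto 0
    simp only [zero_pow (show w ≠ 0 by omega), mul_zero, Prod.mk_zero_zero] at this
    exact this.mono_left nhdsWithin_le_nhds
  have hsm : ∀ δ > 0, ∀ᶠ r in 𝓝[>] (0 : ℝ), r * R < δ ∧ r ^ 2 * R ^ 2 < δ := by
    intro δ hδ
    have h1 : ContinuousAt (fun r : ℝ => r * R) 0 := by fun_prop
    have h2 : ContinuousAt (fun r : ℝ => r ^ 2 * R ^ 2) 0 := by fun_prop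
    exact nhdsWithin_le_nhds ((h1.eventually (gt_mem_nhds (by simpa using hδ))).and
      (h2.eventually (gt_mem_nhds (by simpa using hδ))))
  filter_upwards [hbound, (hline 1).eventually (hev.and hbdd),
    (hline (-1)).eventually (hev.and hbdd),
    hsm δ₁ hδ₁, hsm δ₂ hδ₂, self_mem_nhdsWithin] with r hb hp hn hs₁ hs₂ hr y₁ y₂ hy₁ hy₂
  have hr : 0 < r := hr
  have a₁ := halfArc_of_isPolarArc hc hsplit hsmall₁ hr hs₁.1 hs₁.2 hp.2 hp.1
  have hpn := hn.1
  have hm : ∀ z, c.reflect.polarMass z = c.polarMass z := fun z => by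
    ext t; rw [polarMass_apply, polarMass_apply, mass_reflect]
  have hf : ∀ z, c.reflect.polarForce v o ε z = c.polarForce v o ε z := fun z => by
    simp only [polarForce, hm]
  rw [← hm, ← hf] at hpn
  have a₂ := halfArc_of_isPolarArc hc.reflect hsplit.reflect hsmall₂ hr hs₂.1 hs₂.2 hn.2 hpn
  have hr2 : r ^ 2 ≠ 0 := (pow_pos hr 2).ne'
  have e₁ := mul_left_cancel₀ hr2 (hy₁.unique c.param.contDiff_lienardField a₁)
  have e₂ := mul_left_cancel₀ hr2 (hy₂.unique c.param.reflect.contDiff_lienardField a₂)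
  rw [e₁, e₂]
  simpa [hG] using hb

namespace KuklesParam

/-- The parameters after the scaling of `y` that makes `a₃₀ = 1`. -/
noncomputable def normalize (k : ℝ) (p : KuklesParam) : KuklesParam :=
  (p.1 / k, p.2.1, p.2.2.1 / k ^ 2, p.2.2.2.1 / k, p.2.2.2.2.1, p.2.2.2.2.2 * k)

end KuklesParam

lemma HalfArc.normalize {k : ℝ} (hk : 0 < k) {p : KuklesParam} {y₀ y₁ : ℝ}
    (h : HalfArc p.poly y₀ y₁) : HalfArc (p.normalize k).poly (y₀ / k) (y₁ / k) := by
  obtain ⟨T, hT, x, y, hd, hx0, hy0, hxT, hyT, hpos⟩ := h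
  have hmul : ∀ t, HasDerivAt (fun s => s / k) (1 / k) t := fun t => (hasDerivAt_id t).div_const k
  refine ⟨T * k, by positivity, fun t => x (t / k), fun t => y (t / k) / k, ?_,
    by simp [hx0], by simp [hy0], by simp [hxT, hk.ne'], by simp [hyT, hk.ne', neg_div], ?_⟩
  · intro t ht
    obtain ⟨h1, h2⟩ := hd (t / k) ⟨div_nonneg ht.1 hk.le, (div_le_iff₀ hk).2 ht.2⟩
    refine ⟨(h1.comp t (hmul t)).congr_deriv (by ring),
      ((h2.comp t (hmul t)).div_const k).congr_deriv ?_⟩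
    simp only [KuklesParam.poly, KuklesParam.normalize]
    field_simp
  · intro t ht
    exact hpos _ ⟨div_pos ht.1 hk, (div_lt_iff₀ hk).2 ht.2⟩

open Topology in
lemma KuklesParam.NonFlat.of_normalize {k : ℝ} (hk : 0 < k) {p : KuklesParam}
    (h : (p.normalize k).NonFlat) : p.NonFlat := by
  obtain ⟨w, hw, c, hc, h⟩ := h
  have hs : 0 < √k := Real.sqrt_pos.2 hk
  have hsq : √k ^ 2 = k := Real.sq_sqrt hk.le
  refine ⟨w, hw, c / √k ^ w, by positivity, ?_⟩
  have hlim : Filter.Tendsto (fun r : ℝ => r / √k) (𝓝[>] 0) (𝓝[>] 0) := by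
    refine tendsto_nhdsWithin_iff.2 ⟨?_, ?_⟩
    · have hcont : Continuous fun r : ℝ => r / √k := by fun_prop
      simpa using (hcont.tendsto 0).mono_left nhdsWithin_le_nhds
    · filter_upwards [self_mem_nhdsWithin] with r hr using div_pos hr hs
  filter_upwards [hlim.eventually h] with r hr y₁ y₂ h₁ h₂
  have e : ∀ y, r ^ 2 * y / k = (r / √k) ^ 2 * y := fun y => by rw [div_pow, hsq]; ring
  have e' : r ^ 2 / k = (r / √k) ^ 2 := by rw [div_pow, hsq]
  have a₁ := h₁.normalize hk
  have a₂ := h₂.normalize hk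
  rw [e, e'] at a₁ a₂
  have href : p.reflect.normalize k = (p.normalize k).reflect := by
    simp [KuklesParam.normalize, KuklesParam.reflect, neg_div]
  rw [href] at a₂
  have := hr y₁ y₂ a₁ a₂
  rwa [div_pow, ← mul_comm_div] at this

lemma Polynomial.coeff_mul_low (p q : Polynomial ℝ) :
    (p * q).coeff 0 = p.coeff 0 * q.coeff 0 ∧
    (p * q).coeff 1 = p.coeff 0 * q.coeff 1 + p.coeff 1 * q.coeff 0 ∧
    (p * q).coeff 2 = p.coeff 0 * q.coeff 2 + p.coeff 1 * q.coeff 1 + p.coeff 2 * q.coeff 0 ∧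
    (p * q).coeff 3 = p.coeff 0 * q.coeff 3 + p.coeff 1 * q.coeff 2 + p.coeff 2 * q.coeff 1 +
      p.coeff 3 * q.coeff 0 ∧
    (p * q).coeff 4 = p.coeff 0 * q.coeff 4 + p.coeff 1 * q.coeff 3 + p.coeff 2 * q.coeff 2 +
      p.coeff 3 * q.coeff 1 + p.coeff 4 * q.coeff 0 ∧
    (p * q).coeff 5 = p.coeff 0 * q.coeff 5 + p.coeff 1 * q.coeff 4 + p.coeff 2 * q.coeff 3 +
      p.coeff 3 * q.coeff 2 + p.coeff 4 * q.coeff 1 + p.coeff 5 * q.coeff 0 ∧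
    (p * q).coeff 6 = p.coeff 0 * q.coeff 6 + p.coeff 1 * q.coeff 5 + p.coeff 2 * q.coeff 4 +
      p.coeff 3 * q.coeff 3 + p.coeff 4 * q.coeff 2 + p.coeff 5 * q.coeff 1 +
      p.coeff 6 * q.coeff 0 ∧
    (p * q).coeff 7 = p.coeff 0 * q.coeff 7 + p.coeff 1 * q.coeff 6 + p.coeff 2 * q.coeff 5 +
      p.coeff 3 * q.coeff 4 + p.coeff 4 * q.coeff 3 + p.coeff 5 * q.coeff 2 +
      p.coeff 6 * q.coeff 1 + p.coeff 7 * q.coeff 0 := by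
  simp only [coeff_mul, Finset.Nat.sum_antidiagonal_eq_sum_range_succ_mk, Finset.sum_range_succ,
    Finset.sum_range_zero]
  norm_num

open Polynomial in
/-- The polynomial `u₀ + u₁ X + u₃ X³ + u₅ X⁵ + u₇ X⁷`. -/
noncomputable def oddPoly (u₀ u₁ u₃ u₅ u₇ : ℝ) : ℝ[X] :=
  C u₀ + C u₁ * X + C u₃ * X ^ 3 + C u₅ * X ^ 5 + C u₇ * X ^ 7

open Polynomial in
lemma coeff_oddPoly (u₀ u₁ u₃ u₅ u₇ : ℝ) :
    (oddPoly u₀ u₁ u₃ u₅ u₇).coeff 0 = u₀ ∧ (oddPoly u₀ u₁ u₃ u₅ u₇).coeff 1 = u₁ ∧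
    (oddPoly u₀ u₁ u₃ u₅ u₇).coeff 2 = 0 ∧ (oddPoly u₀ u₁ u₃ u₅ u₇).coeff 3 = u₃ ∧
    (oddPoly u₀ u₁ u₃ u₅ u₇).coeff 4 = 0 ∧ (oddPoly u₀ u₁ u₃ u₅ u₇).coeff 5 = u₅ ∧
    (oddPoly u₀ u₁ u₃ u₅ u₇).coeff 6 = 0 ∧ (oddPoly u₀ u₁ u₃ u₅ u₇).coeff 7 = u₇ := by
  simp [oddPoly, coeff_X, coeff_C, coeff_X_pow]

open Polynomial in
lemma oddPoly_comp (u₀ u₁ u₃ u₅ u₇ : ℝ) :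
    (oddPoly u₀ u₁ u₃ u₅ u₇).comp (-X) = oddPoly u₀ (-u₁) (-u₃) (-u₅) (-u₇) := by
  simp only [oddPoly, add_comp, mul_comp, C_comp, X_comp, pow_comp, map_neg]
  ring

lemma eval_oddPoly_zero (u₀ u₁ u₃ u₅ u₇ : ℝ) : (oddPoly u₀ u₁ u₃ u₅ u₇).eval 0 = u₀ := by
  simp [oddPoly]

open Polynomial in
lemma coeff_derivative_oddPoly (u₀ u₁ u₃ u₅ u₇ : ℝ) :
    (derivative (oddPoly u₀ u₁ u₃ u₅ u₇)).coeff 0 = u₁ ∧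
    (derivative (oddPoly u₀ u₁ u₃ u₅ u₇)).coeff 1 = 0 ∧
    (derivative (oddPoly u₀ u₁ u₃ u₅ u₇)).coeff 2 = 3 * u₃ ∧
    (derivative (oddPoly u₀ u₁ u₃ u₅ u₇)).coeff 3 = 0 ∧
    (derivative (oddPoly u₀ u₁ u₃ u₅ u₇)).coeff 4 = 5 * u₅ ∧
    (derivative (oddPoly u₀ u₁ u₃ u₅ u₇)).coeff 5 = 0 ∧
    (derivative (oddPoly u₀ u₁ u₃ u₅ u₇)).coeff 6 = 7 * u₇ := by
  obtain ⟨-, h1, h2, h3, h4, h5, h6, h7⟩ := coeff_oddPoly u₀ u₁ u₃ u₅ u₇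
  refine ⟨?_, ?_, ?_, ?_, ?_, ?_, ?_⟩ <;> rw [coeff_derivative] <;>
    norm_num only [h1, h2, h3, h4, h5, h6, h7] <;> ring

open Polynomial in
lemma Polynomial.coeff_X_low : (X : ℝ[X]).coeff 0 = 0 ∧ (X : ℝ[X]).coeff 1 = 1 ∧
    (X : ℝ[X]).coeff 2 = 0 ∧ (X : ℝ[X]).coeff 3 = 0 ∧ (X : ℝ[X]).coeff 4 = 0 ∧
    (X : ℝ[X]).coeff 5 = 0 ∧ (X : ℝ[X]).coeff 6 = 0 ∧ (X : ℝ[X]).coeff 7 = 0 := by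
  simp [coeff_X]

open Polynomial in
lemma Polynomial.coeff_C_low (r : ℝ) : (C r).coeff 0 = r ∧ (C r).coeff 1 = 0 ∧
    (C r).coeff 2 = 0 ∧ (C r).coeff 3 = 0 ∧ (C r).coeff 4 = 0 ∧ (C r).coeff 5 = 0 ∧
    (C r).coeff 6 = 0 ∧ (C r).coeff 7 = 0 := by
  simp [coeff_C]

open Polynomial in
lemma oddPoly_add_X_mul_derivative (u₀ u₁ u₃ u₅ u₇ : ℝ) :
    oddPoly u₀ u₁ u₃ u₅ u₇ + X * derivative (oddPoly u₀ u₁ u₃ u₅ u₇) =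
      oddPoly u₀ (2 * u₁) (4 * u₃) (6 * u₅) (8 * u₇) := by
  simp only [oddPoly, derivative_add, derivative_mul, derivative_C, derivative_X_pow,
    derivative_X, map_mul, map_ofNat]
  norm_num
  rw [show (C 3 : ℝ[X]) = 3 from rfl, show (C 5 : ℝ[X]) = 5 from rfl,
    show (C 7 : ℝ[X]) = 7 from rfl]
  ring

/-- The chart with odd-power corrections. -/
noncomputable def oddChart (a b c d e x₁ x₃ x₅ x₇ m₁ m₃ m₅ m₇ p₁ p₃ p₅ : ℝ) : Chart :=
  ⟨(a, b, 1, d, c, e), oddPoly 1 x₁ x₃ x₅ x₇, oddPoly 1 m₁ m₃ m₅ m₇, oddPoly 0 p₁ p₃ p₅ 0⟩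

lemma oddChart_isNormalized (a b c d e x₁ x₃ x₅ x₇ m₁ m₃ m₅ m₇ p₁ p₃ p₅ : ℝ) :
    (oddChart a b c d e x₁ x₃ x₅ x₇ m₁ m₃ m₅ m₇ p₁ p₃ p₅).IsNormalized :=
  ⟨rfl, eval_oddPoly_zero .., eval_oddPoly_zero .., eval_oddPoly_zero ..⟩

open Polynomial in
lemma cubic_oddChart (a b c d e x₁ x₃ x₅ x₇ m₁ m₃ m₅ m₇ p₁ p₃ p₅ : ℝ) :
    (oddChart a b c d e x₁ x₃ x₅ x₇ m₁ m₃ m₅ m₇ p₁ p₃ p₅).cubic.coeff 1 = 2 * m₁ + 5 * x₁ ∧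
    (oddChart a b c d e x₁ x₃ x₅ x₇ m₁ m₃ m₅ m₇ p₁ p₃ p₅).cubic.coeff 3 = 2 * m₃ +
      5 * x₁ * m₁ ^ 2 + 18 * x₁ ^ 2 * m₁ + 7 * x₁ ^ 3 + 7 * x₃ ∧
    (oddChart a b c d e x₁ x₃ x₅ x₇ m₁ m₃ m₅ m₇ p₁ p₃ p₅).cubic.coeff 5 = 2 * m₅ +
      10 * x₁ * m₁ * m₃ + 48 * x₁ * m₁ * x₃ + 18 * x₁ ^ 2 * m₃ + 27 * x₁ ^ 2 * x₃ +
      7 * x₁ ^ 3 * m₁ ^ 2 + 4 * x₁ ^ 4 * m₁ + 7 * m₁ ^ 2 * x₃ + 9 * x₅ ∧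
    (oddChart a b c d e x₁ x₃ x₅ x₇ m₁ m₃ m₅ m₇ p₁ p₃ p₅).cubic.coeff 7 = 2 * m₇ +
      10 * x₁ * m₁ * m₅ + 60 * x₁ * m₁ * x₅ + 48 * x₁ * m₃ * x₃ + 5 * x₁ * m₃ ^ 2 +
      33 * x₁ * x₃ ^ 2 + 27 * x₁ ^ 2 * m₁ ^ 2 * x₃ + 18 * x₁ ^ 2 * m₅ + 33 * x₁ ^ 2 * x₅ +
      14 * x₁ ^ 3 * m₁ * m₃ + 20 * x₁ ^ 3 * m₁ * x₃ + 4 * x₁ ^ 4 * m₃ + 14 * m₁ * m₃ * x₃ +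
      30 * m₁ * x₃ ^ 2 + 9 * m₁ ^ 2 * x₅ + 11 * x₇ := by
  simp only [oddChart, Chart.cubic, Chart.dx, oddPoly_add_X_mul_derivative, coeff_mul_low,
    coeff_oddPoly, pow_succ, pow_zero, one_mul, mul_zero, zero_mul, add_zero, zero_add]
  refine ⟨?_, ?_, ?_, ?_⟩ <;> ring

open Polynomial in
lemma mixed_oddChart (a b c d e x₁ x₃ x₅ x₇ m₁ m₃ m₅ m₇ p₁ p₃ p₅ : ℝ) :
    (oddChart a b c d e x₁ x₃ x₅ x₇ m₁ m₃ m₅ m₇ p₁ p₃ p₅).mixed.coeff 1 = 3 * a * x₁ + a * m₁ + d ∧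
    (oddChart a b c d e x₁ x₃ x₅ x₇ m₁ m₃ m₅ m₇ p₁ p₃ p₅).mixed.coeff 3 = 5 * a * x₃ +
      2 * a * x₁ ^ 2 * m₁ + a * m₃ + 4 * d * x₁ * m₁ + 5 * d * x₁ ^ 2 + 3 * p₁ ∧
    (oddChart a b c d e x₁ x₃ x₅ x₇ m₁ m₃ m₅ m₇ p₁ p₃ p₅).mixed.coeff 5 = 7 * a * x₅ +
      6 * a * x₁ * x₃ * m₁ + 2 * a * x₁ ^ 2 * m₃ + a * m₅ + 14 * d * x₁ * x₃ + 4 * d * x₁ * m₃ +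
      2 * d * x₁ ^ 3 * m₁ + 6 * d * x₃ * m₁ + 15 * x₁ * p₁ * m₁ + 27 * x₁ ^ 2 * p₁ + 3 * p₃ ∧
    (oddChart a b c d e x₁ x₃ x₅ x₇ m₁ m₃ m₅ m₇ p₁ p₃ p₅).mixed.coeff 7 = 9 * a * x₇ +
      8 * a * x₁ * x₅ * m₁ + 6 * a * x₁ * x₃ * m₃ + 2 * a * x₁ ^ 2 * m₅ + 4 * a * x₃ ^ 2 * m₁ +
      a * m₇ + 18 * d * x₁ * x₅ + 4 * d * x₁ * m₅ + 8 * d * x₁ ^ 2 * x₃ * m₁ +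
      2 * d * x₁ ^ 3 * m₃ + 8 * d * x₅ * m₁ + 6 * d * x₃ * m₃ + 9 * d * x₃ ^ 2 +
      72 * x₁ * x₃ * p₁ + 15 * x₁ * p₃ * m₁ + 15 * x₁ * p₁ * m₃ + 27 * x₁ ^ 2 * p₃ +
      21 * x₁ ^ 3 * p₁ * m₁ + 6 * x₁ ^ 4 * p₁ + 21 * x₃ * p₁ * m₁ + 3 * p₅ := by
  simp only [oddChart, Chart.mixed, Chart.dx, show (3 : ℝ[X]) = C 3 from rfl, coeff_add,
    coeff_C_low,
    coeff_X_low, oddPoly_add_X_mul_derivative, coeff_mul_low, coeff_oddPoly, pow_succ,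
    pow_zero, one_mul, mul_zero, zero_mul, add_zero, zero_add]
  refine ⟨?_, ?_, ?_, ?_⟩ <;> ring

open Polynomial in
lemma quad_oddChart (a b c d e x₁ x₃ x₅ x₇ m₁ m₃ m₅ m₇ p₁ p₃ p₅ : ℝ) :
    (oddChart a b c d e x₁ x₃ x₅ x₇ m₁ m₃ m₅ m₇ p₁ p₃ p₅).quad.coeff 0 = b - m₁ ∧
    (oddChart a b c d e x₁ x₃ x₅ x₇ m₁ m₃ m₅ m₇ p₁ p₃ p₅).quad.coeff 2 = 2 * a * p₁ + 3 * c * x₁ -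
      m₁ ^ 2 * b - 3 * m₃ ∧
    (oddChart a b c d e x₁ x₃ x₅ x₇ m₁ m₃ m₅ m₇ p₁ p₃ p₅).quad.coeff 4 = 2 * a * p₃ +
      4 * a * x₁ ^ 2 * p₁ - 2 * a * p₁ * m₁ ^ 2 + 8 * d * x₁ * p₁ - 3 * x₁ * c * m₁ ^ 2 +
      5 * c * x₃ - 2 * m₁ * m₃ * b - 5 * m₅ ∧
    (oddChart a b c d e x₁ x₃ x₅ x₇ m₁ m₃ m₅ m₇ p₁ p₃ p₅).quad.coeff 6 = 12 * x₁ * p₁ * a * x₃ -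
      8 * x₁ * p₁ * d * m₁ ^ 2 + 15 * x₁ * p₁ ^ 2 + 8 * x₁ * d * p₃ - 6 * x₁ * c * m₁ * m₃ -
      4 * x₁ ^ 2 * p₁ * a * m₁ ^ 2 + 4 * x₁ ^ 2 * a * p₃ + 4 * x₁ ^ 3 * p₁ * d -
      4 * p₁ * a * m₁ * m₃ + 12 * p₁ * d * x₃ + 2 * a * p₅ - 2 * a * p₃ * m₁ ^ 2 -
      5 * x₃ * c * m₁ ^ 2 + 7 * c * x₅ - 2 * m₁ * m₅ * b - m₃ ^ 2 * b - 7 * m₇ := by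
  simp only [oddChart, Chart.quad, Chart.dx, show (3 : ℝ[X]) = C 3 from rfl,
    show (2 : ℝ[X]) = C 2 from rfl, coeff_add, coeff_C_low, coeff_X_low, coeff_sub, coeff_derivative_oddPoly,
    oddPoly_comp, oddPoly_add_X_mul_derivative, coeff_mul_low, coeff_oddPoly, pow_succ,
    pow_zero, one_mul, mul_zero, zero_mul, add_zero, zero_add, true_and]
  refine ⟨?_, ?_, ?_⟩ <;> ring

open Polynomial in
lemma cube_oddChart (a b c d e x₁ x₃ x₅ x₇ m₁ m₃ m₅ m₇ p₁ p₃ p₅ : ℝ) :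
    (oddChart a b c d e x₁ x₃ x₅ x₇ m₁ m₃ m₅ m₇ p₁ p₃ p₅).cube.coeff 0 = e - p₁ ∧
    (oddChart a b c d e x₁ x₃ x₅ x₇ m₁ m₃ m₅ m₇ p₁ p₃ p₅).cube.coeff 2 = c * p₁ +
      2 * p₁ * x₁ * b - p₁ * b * m₁ - 2 * x₁ * m₁ * e - 3 * p₃ ∧
    (oddChart a b c d e x₁ x₃ x₅ x₇ m₁ m₃ m₅ m₇ p₁ p₃ p₅).cube.coeff 4 = 3 * a * x₁ * p₁ ^ 2 -
      a * p₁ ^ 2 * m₁ - 3 * x₁ * p₁ * c * m₁ + 2 * x₁ * p₃ * b - 2 * x₁ * e * m₃ +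
      2 * x₁ ^ 2 * p₁ * c + d * p₁ ^ 2 + 4 * p₁ * b * x₃ - p₁ * b * m₃ + c * p₃ - p₃ * b * m₁ -
      4 * x₃ * m₁ * e - 5 * p₅ := by
  simp only [oddChart, Chart.cube, Chart.dx, coeff_add, coeff_C_low, coeff_X_low, coeff_sub,
    coeff_derivative_oddPoly, oddPoly_comp, oddPoly_add_X_mul_derivative, coeff_mul_low,
    coeff_oddPoly, pow_succ, pow_zero, one_mul, mul_zero, zero_mul, add_zero, zero_add,
    true_and]
  refine ⟨?_, ?_⟩ <;> ring

lemma Chart.hasWeight_of_coeff {c : Chart} {v : ℕ} (hv : v ≤ 3)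
    (h1 : c.cubic.coeff 1 = 0) (h3 : 1 ≤ v → c.cubic.coeff 3 = 0)
    (h5 : 2 ≤ v → c.cubic.coeff 5 = 0) (h7 : 3 ≤ v → c.cubic.coeff 7 = 0)
    (k1 : 1 ≤ v → c.mixed.coeff 1 = 0) (k3 : 2 ≤ v → c.mixed.coeff 3 = 0)
    (k5 : 3 ≤ v → c.mixed.coeff 5 = 0)
    (q0 : c.quad.coeff 0 = 0) (q2 : 1 ≤ v → c.quad.coeff 2 = 0)
    (q4 : 2 ≤ v → c.quad.coeff 4 = 0) (q6 : 3 ≤ v → c.quad.coeff 6 = 0)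
    (r0 : 1 ≤ v → c.cube.coeff 0 = 0) (r2 : 2 ≤ v → c.cube.coeff 2 = 0)
    (r4 : 3 ≤ v → c.cube.coeff 4 = 0) (hne : c.mixed.coeff (2 * v + 1) ≠ 0) :
    c.HasWeight v := by
  constructor
  · intro i hi
    interval_cases v <;> interval_cases i <;> simp_all
  · intro i hi
    interval_cases v <;> interval_cases i <;> simp_all
  · intro i hi
    interval_cases v <;> interval_cases i <;> simp_all
  · intro i hi
    interval_cases v <;> interval_cases i <;> simp_all
  · exact hne

/-- The two obstruction polynomials of the highest weights have no common zero. -/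
lemma obstruction_no_common_zero {L T : ℝ} (h0 : 0 ≤ L) (h8 : L < 8)
    (hf : (-18703125 + 2437500 * L - 62500 * L ^ 2) * T ^ 2 + (61875 + 18750 * L) * T + 628 = 0)
    (hg : (-21188671875 + 5758593750 * L - 520312500 * L ^ 2 + 15625000 * L ^ 3) * T ^ 3 +
      (32234906250 - 3622987500 * L + 103250000 * L ^ 2) * T ^ 2 +
      (-38512875 - 31818250 * L) * T - 923168 = 0) : False := by
  have hlin : (636667158375 - 82831241250 * L + 8831929500 * L ^ 2 - 232521000 * L ^ 3 -
      800000 * L ^ 4) * T + (1486242405 - 68426586 * L + 5084316 * L ^ 2 - 179320 * L ^ 3) = 0 := by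
    linear_combination ((-133/12500 + 13/9375 * L - 1/28125 * L ^ 2) * (-890625 + 31250 * L)) * hg -
      ((-133/12500 + 13/9375 * L - 1/28125 * L ^ 2) * (-1008984375 + 178125000 * L -
          7812500 * L ^ 2) * T +
        (-65187345/4 + 4826409/2 * L - 118347 * L ^ 2 + 17270/9 * L ^ 3)) * hf
  have hres : (21 - 2 * L) * (94501673970752507 + 102096616949008979 * (8 - L) +
      8523493515849084 * (8 - L) ^ 2 + 1071451227737380 * (8 - L) ^ 3 +
      150707804923600 * (8 - L) ^ 4 +
      7921388845392 * (8 - L) ^ 5 + 113425156160 * (8 - L) ^ 6 - 848910400 * (8 - L) ^ 7)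
      = 0 := by
    linear_combination 1/2531250 * ((636667158375 - 82831241250 * L + 8831929500 * L ^ 2 -
        232521000 * L ^ 3 - 800000 * L ^ 4) ^ 2 * hf +
      ((-18703125 + 2437500 * L - 62500 * L ^ 2) * (1486242405 - 68426586 * L + 5084316 * L ^ 2 -
          179320 * L ^ 3) - (-18703125 + 2437500 * L - 62500 * L ^ 2) * (636667158375 -
          82831241250 * L + 8831929500 * L ^ 2 - 232521000 * L ^ 3 - 800000 * L ^ 4) * T -
          (61875 + 18750 * L) * (636667158375 - 82831241250 * L + 8831929500 * L ^ 2 -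
          232521000 * L ^ 3 - 800000 * L ^ 4)) * hlin)
  have hs : 0 < 8 - L := by linarith
  have h67 : 0 ≤ 113425156160 * (8 - L) ^ 6 - 848910400 * (8 - L) ^ 7 := by
    have : 0 ≤ (8 - L) ^ 6 * (113425156160 - 848910400 * (8 - L)) := by
      refine mul_nonneg (by positivity) (by linarith)
    linarith
  have hpos : 0 < 94501673970752507 + 102096616949008979 * (8 - L) +
      8523493515849084 * (8 - L) ^ 2 + 1071451227737380 * (8 - L) ^ 3 +
      150707804923600 * (8 - L) ^ 4 +
      7921388845392 * (8 - L) ^ 5 := by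
    positivity
  rcases mul_eq_zero.1 hres with h | h <;> linarith

/-- The chart for parameters at which the two obstructions of lowest weight vanish. -/
noncomputable def obstructionChart (a b t : ℝ) : Chart :=
  oddChart a b ((b ^ 2 - 25 * (21 - 2 * a ^ 2) * t) / 30) (a * b / 5) (a * b * t)
    (-2 * b / 5)
    (-2 * b * t + 14 / 375 * b ^ 3)
    (34 / 27 * a ^ 2 * b * t ^ 2 + 2 / 135 * a ^ 2 * b ^ 3 * t - 4 / 81 * a ^ 4 * b * t ^ 2 -
      70 / 9 * b * t ^ 2 + 188 / 225 * b ^ 3 * t - 1246 / 253125 * b ^ 5)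
    (175 / 33 * a ^ 2 * b * t ^ 3 - 7822 / 14175 * a ^ 2 * b ^ 3 * t ^ 2 -
      92623 / 11694375 * a ^ 2 * b ^ 5 * t - 100 / 297 * a ^ 4 * b * t ^ 3 +
      68 / 2673 * a ^ 4 * b ^ 3 * t ^ 2 + 100 / 18711 * a ^ 6 * b * t ^ 3 -
      2450 / 99 * b * t ^ 3 + 16114 / 1485 * b ^ 3 * t ^ 2 - 126454 / 556875 * b ^ 5 * t +
      1027706 / 1461796875 * b ^ 7)
    (b)
    (7 * b * t - 26 / 75 * b ^ 3)
    (-17 / 3 * a ^ 2 * b * t ^ 2 - 1 / 15 * a ^ 2 * b ^ 3 * t + 2 / 9 * a ^ 4 * b * t ^ 2 +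
      35 * b * t ^ 2 - 193 / 25 * b ^ 3 * t + 832 / 5625 * b ^ 5)
    (-175 / 6 * a ^ 2 * b * t ^ 3 + 16958 / 2835 * a ^ 2 * b ^ 3 * t ^ 2 +
      166333 / 2126250 * a ^ 2 * b ^ 5 * t + 50 / 27 * a ^ 4 * b * t ^ 3 -
      1552 / 6075 * a ^ 4 * b ^ 3 * t ^ 2 - 50 / 1701 * a ^ 6 * b * t ^ 3 + 1225 / 9 * b * t ^ 3 -
      13349 / 135 * b ^ 3 * t ^ 2 + 287921 / 50625 * b ^ 5 * t - 1712786 / 26578125 * b ^ 7)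
    (a * b * t)
    (-35 / 6 * a * b * t ^ 2 - 29 / 90 * a * b ^ 3 * t + 5 / 9 * a ^ 3 * b * t ^ 2)
    (245 / 12 * a * b * t ^ 3 - 217 / 90 * a * b ^ 3 * t ^ 2 + 1861 / 13500 * a * b ^ 5 * t -
      35 / 9 * a ^ 3 * b * t ^ 3 - 133 / 675 * a ^ 3 * b ^ 3 * t ^ 2 + 5 / 27 * a ^ 5 * b * t ^ 3)

lemma obstructionChart_isNormalized (a b t : ℝ) : (obstructionChart a b t).IsNormalized :=
  oddChart_isNormalized ..

lemma obstructionChart_coeff (a b t : ℝ) :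
    ((obstructionChart a b t).cubic.coeff 1 = 0 ∧ (obstructionChart a b t).cubic.coeff 3 = 0 ∧
      (obstructionChart a b t).cubic.coeff 5 = 0 ∧ (obstructionChart a b t).cubic.coeff 7 = 0) ∧
    ((obstructionChart a b t).mixed.coeff 1 = 0 ∧ (obstructionChart a b t).mixed.coeff 3 = 0) ∧
    ((obstructionChart a b t).quad.coeff 0 = 0 ∧ (obstructionChart a b t).quad.coeff 2 = 0 ∧
      (obstructionChart a b t).quad.coeff 4 = 0 ∧ (obstructionChart a b t).quad.coeff 6 = 0) ∧
    (obstructionChart a b t).cube.coeff 0 = 0 ∧ (obstructionChart a b t).cube.coeff 2 = 0 ∧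
    (obstructionChart a b t).cube.coeff 4 = 0 := by
  simp only [obstructionChart, cubic_oddChart, mixed_oddChart, quad_oddChart, cube_oddChart]
  refine ⟨⟨?_, ?_, ?_, ?_⟩, ⟨?_, ?_⟩, ⟨?_, ?_, ?_, ?_⟩, ?_, ?_, ?_⟩ <;> ring

lemma obstructionChart_mixed (a b t : ℝ) :
    (obstructionChart a b t).mixed.coeff 5 =
      -665 / 18 * a * b * t ^ 2 + 11 / 90 * a * b ^ 3 * t + 314 / 253125 * a * b ^ 5 +
        130 / 27 * a ^ 3 * b * t ^ 2 + 1 / 27 * a ^ 3 * b ^ 3 * t - 10 / 81 * a ^ 5 * b * t ^ 2 ∧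
    (obstructionChart a b t).mixed.coeff 7 =
      -10045 / 396 * a * b * t ^ 3 + 114613 / 2970 * a * b ^ 3 * t ^ 2 -
        102701 / 2227500 * a * b ^ 5 * t - 230792 / 208828125 * a * b ^ 7 +
        455 / 66 * a ^ 3 * b * t ^ 3 - 8783 / 2025 * a ^ 3 * b ^ 3 * t ^ 2 -
        127273 / 3341250 * a ^ 3 * b ^ 5 * t - 185 / 297 * a ^ 5 * b * t ^ 3 +
        1652 / 13365 * a ^ 5 * b ^ 3 * t ^ 2 + 50 / 2673 * a ^ 7 * b * t ^ 3 := by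
  simp only [obstructionChart, mixed_oddChart]
  constructor <;> ring

lemma obstructionChart_mixed_ne {a b : ℝ} (t : ℝ) (ha : a ^ 2 < 8) (hab : a * b ≠ 0) :
    (obstructionChart a b t).mixed.coeff 5 ≠ 0 ∨ (obstructionChart a b t).mixed.coeff 7 ≠ 0 := by
  by_contra! h
  rw [(obstructionChart_mixed a b t).1, (obstructionChart_mixed a b t).2] at h
  have hb : b ≠ 0 := right_ne_zero_of_mul hab
  have ha0 : a ≠ 0 := left_ne_zero_of_mul hab
  obtain ⟨T, rfl⟩ : ∃ T, t = T * b ^ 2 := ⟨t / b ^ 2, by field_simp⟩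
  refine obstruction_no_common_zero (L := a ^ 2) (T := T) (sq_nonneg a) ha ?_ ?_
  · refine (mul_eq_zero.1 (?_ : a * b ^ 5 * _ = 0)).resolve_left (by positivity)
    linear_combination 506250 * h.1
  · refine (mul_eq_zero.1 (?_ : a * b ^ 7 * _ = 0)).resolve_left (by positivity)
    linear_combination 835312500 * h.2

lemma hasWeight_one_oddChart {a b c e : ℝ}
    (h : 6 / 35 * a * b * c - a * b ^ 3 / 175 + (3 - 2 / 7 * a ^ 2) * e ≠ 0) :
    (oddChart a b c (a * b / 5) e (-2 * b / 5)
      (-4 / 21 * a * e + 4 / 35 * b * c + 88 / 2625 * b ^ 3) 0 0 b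
      (2 / 3 * a * e - 2 / 5 * b * c - 1 / 3 * b ^ 3) 0 0 e 0 0).HasWeight 1 := by
  refine Chart.hasWeight_of_coeff (by norm_num) ?_ (fun _ => ?_) (fun h => by omega)
    (fun h => by omega) (fun _ => ?_) (fun h => by omega) (fun h => by omega) ?_ (fun _ => ?_)
    (fun h => by omega) (fun h => by omega) (fun _ => ?_) (fun h => by omega)
    (fun h => by omega) ?_ <;>
    norm_num only [cubic_oddChart, mixed_oddChart, quad_oddChart, cube_oddChart]
  · ring
  · ring
  · ring
  · ring
  · ring
  · ring
  · refine fun h' => h ?_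
    linear_combination h'

lemma hasWeight_zero_oddChart {a b c d e : ℝ} (h : d ≠ a * b / 5) :
    (oddChart a b c d e (-2 * b / 5) 0 0 0 b 0 0 0 0 0 0).HasWeight 0 := by
  refine Chart.hasWeight_of_coeff (by norm_num) ?_ (fun h => by omega) (fun h => by omega)
    (fun h => by omega) (fun h => by omega) (fun h => by omega) (fun h => by omega) ?_
    (fun h => by omega) (fun h => by omega) (fun h => by omega) (fun h => by omega)
    (fun h => by omega) (fun h => by omega) ?_ <;>
    norm_num only [cubic_oddChart, mixed_oddChart, quad_oddChart, cube_oddChart]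
  · ring
  · ring
  · refine fun h' => h ?_
    linear_combination h'

/-- Every normalized system that satisfies the nondegeneracy condition has a chart of weight at
most three. -/
lemma exists_chart_hasWeight {a b c d e : ℝ} (ha : a ^ 2 < 8)
    (h : ¬ (d = 0 ∧ e = 0 ∧ a * b = 0)) :
    ∃ (C : Chart) (v : ℕ), C.param = (a, b, 1, d, c, e) ∧ C.IsNormalized ∧ v ≤ 3 ∧
      C.HasWeight v := by
  by_cases h1 : d = a * b / 5
  · subst h1
    have hab : a * b ≠ 0 ∨ e ≠ 0 := by
      by_contra! h'
      exact h ⟨by rw [h'.1]; norm_num, h'.2, h'.1⟩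
    have hK : 21 - 2 * a ^ 2 ≠ 0 := by linarith
    by_cases h3 : 6 / 35 * a * b * c - a * b ^ 3 / 175 + (3 - 2 / 7 * a ^ 2) * e = 0
    · obtain ⟨t, ht⟩ : ∃ t, t * (25 * (21 - 2 * a ^ 2)) = b ^ 2 - 30 * c :=
        ⟨(b ^ 2 - 30 * c) / (25 * (21 - 2 * a ^ 2)), by field_simp⟩
      have he : e = a * b * t := by
        refine mul_left_cancel₀ hK ?_
        linear_combination 7 * h3 - a * b / 25 * ht
      have hc : c = (b ^ 2 - 25 * (21 - 2 * a ^ 2) * t) / 30 := by linarith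
      subst he hc
      have hab' : a * b ≠ 0 := by
        rcases hab with hab | hab
        · exact hab
        · exact left_ne_zero_of_mul hab
      obtain ⟨⟨x1, x3, x5, x7⟩, ⟨k1, k3⟩, ⟨q0, q2, q4, q6⟩, r0, r2, r4⟩ :=
        obstructionChart_coeff a b t
      by_cases h5 : (obstructionChart a b t).mixed.coeff 5 = 0
      · have h7 := (obstructionChart_mixed_ne t ha hab').resolve_left (not_not.2 h5)
        exact ⟨obstructionChart a b t, 3, rfl, obstructionChart_isNormalized a b t, le_rfl,
          Chart.hasWeight_of_coeff le_rfl x1 (fun _ => x3) (fun _ => x5) (fun _ => x7)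
            (fun _ => k1) (fun _ => k3) (fun _ => h5) q0 (fun _ => q2) (fun _ => q4) (fun _ => q6)
            (fun _ => r0) (fun _ => r2) (fun _ => r4) h7⟩
      · exact ⟨obstructionChart a b t, 2, rfl, obstructionChart_isNormalized a b t, by norm_num,
          Chart.hasWeight_of_coeff (by norm_num) x1 (fun _ => x3) (fun _ => x5) (fun h => by omega)
            (fun _ => k1) (fun _ => k3) (fun h => by omega) q0 (fun _ => q2) (fun _ => q4)
            (fun h => by omega) (fun _ => r0) (fun _ => r2) (fun h => by omega) h5⟩
    · exact ⟨_, 1, rfl, oddChart_isNormalized .., by norm_num, hasWeight_one_oddChart h3⟩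
  · exact ⟨_, 0, rfl, oddChart_isNormalized .., by norm_num, hasWeight_zero_oddChart h1⟩

lemma KuklesParam.nonFlat {p : KuklesParam} (hpos : 0 < p.2.2.1) (ha : p.1 ^ 2 < 8 * p.2.2.1)
    (h : ¬ (p.2.2.2.1 = 0 ∧ p.2.2.2.2.2 = 0 ∧ p.1 * p.2.1 = 0)) : p.NonFlat := by
  have hk : 0 < √p.2.2.1 := Real.sqrt_pos.2 hpos
  have hsq : √p.2.2.1 ^ 2 = p.2.2.1 := Real.sq_sqrt hpos.le
  set k := √p.2.2.1 with hk_def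
  have ha' : (p.1 / k) ^ 2 < 8 := by
    rw [div_pow, hsq, div_lt_iff₀ hpos]; exact ha
  have h' : ¬ (p.2.2.2.1 / k = 0 ∧ p.2.2.2.2.2 * k = 0 ∧ p.1 / k * p.2.1 = 0) := by
    simpa [hk.ne', div_mul_eq_mul_div] using h
  obtain ⟨C, v, hC, hn, hv, hw⟩ := exists_chart_hasWeight (c := p.2.2.2.2.1) ha' h'
  have hCp : C.param = p.normalize k := by
    rw [hC, KuklesParam.normalize, hsq, div_self hpos.ne']
  refine KuklesParam.NonFlat.of_normalize hk ?_
  rw [← hCp]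
  refine Chart.nonFlat hn ?_ hv hw
  rw [hC]; exact ha'

/-- A locally uniform bound on the number of small periodic orbits is uniform on compact sets of
parameters. -/
lemma exists_uniform_card_orbits_le_three {D : Set KuklesParam} (hD : IsCompact D)
    (ha : ∀ p ∈ D, p.1 ^ 2 < 8 * p.2.2.1) (hflat : ∀ p ∈ D, p.NonFlat) :
    ∃ δ > 0, ∀ p ∈ D, ∀ S : Finset (Set (ℝ × ℝ)),
      (∀ Γ ∈ S, IsPeriodicOrbit p.poly Γ ∧ ∀ z ∈ Γ, |z.2| < δ) → S.card ≤ 3 := by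
  refine hD.induction_on (p := fun E => ∃ δ > 0, ∀ p ∈ E, ∀ S : Finset (Set (ℝ × ℝ)),
      (∀ Γ ∈ S, IsPeriodicOrbit p.poly Γ ∧ ∀ z ∈ Γ, |z.2| < δ) → S.card ≤ 3) ?_ ?_ ?_ ?_
  · exact ⟨1, one_pos, by simp⟩
  · rintro E F hEF ⟨δ, hδ, h⟩
    exact ⟨δ, hδ, fun p hp => h p (hEF hp)⟩
  · rintro E F ⟨δ, hδ, h⟩ ⟨δ', hδ', h'⟩
    refine ⟨min δ δ', lt_min hδ hδ', ?_⟩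
    rintro p (hp | hp) S hS
    · exact h p hp S fun Γ hΓ => ⟨(hS Γ hΓ).1, fun z hz =>
        ((hS Γ hΓ).2 z hz).trans_le (min_le_left _ _)⟩
    · exact h' p hp S fun Γ hΓ => ⟨(hS Γ hΓ).1, fun z hz =>
        ((hS Γ hΓ).2 z hz).trans_le (min_le_right _ _)⟩
  · intro p hp
    obtain ⟨δ, hδ, h⟩ := KuklesParam.exists_card_orbits_le_three (ha p hp) (hflat p hp)
    exact ⟨_, mem_nhdsWithin_of_mem_nhds h, δ, hδ, fun q hq => hq⟩

lemma Set.finite_and_ncard_le_of_finset {α : Type*} {A : Set α} {n : ℕ}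
    (h : ∀ S : Finset α, ↑S ⊆ A → S.card ≤ n) : A.Finite ∧ A.ncard ≤ n := by
  have hfin : A.Finite := by
    by_contra hinf
    obtain ⟨S, hS, hcard⟩ := Set.Infinite.exists_subset_card_eq hinf (n + 1)
    exact absurd (h S hS) (by omega)
  refine ⟨hfin, ?_⟩
  rw [Set.ncard_eq_toFinset_card A hfin]
  exact h _ (by simp)

/-- **Proposition 4.1.**  On a compact set of parameters with `a₃₀ > 0`,
`a₁₁² - 8a₃₀ < 0` and `|a₂₁| + |a₀₃| + |a₁₁a₀₂| > 0`, the Kukles-type system (4.1)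
has at most `3` limit cycles in some fixed neighborhood `V` of the origin. -/
theorem kukles_at_most_three_limit_cycles
    (D : Set (ℝ × ℝ × ℝ × ℝ × ℝ × ℝ)) (hD : IsCompact D)
    (hcond : ∀ a11 a02 a30 a21 a12 a03 : ℝ, (a11, a02, a30, a21, a12, a03) ∈ D →
      0 < a30 ∧ a11 ^ 2 - 8 * a30 < 0 ∧ 0 < |a21| + |a03| + |a11 * a02|) :
    ∃ V ∈ nhds (0 : ℝ × ℝ), ∀ a11 a02 a30 a21 a12 a03 : ℝ,
      (a11, a02, a30, a21, a12, a03) ∈ D →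
      {Γ : Set (ℝ × ℝ) | IsKuklesLimitCycle a11 a02 a30 a21 a12 a03 Γ ∧ Γ ⊆ V}.Finite ∧
      {Γ : Set (ℝ × ℝ) | IsKuklesLimitCycle a11 a02 a30 a21 a12 a03 Γ ∧ Γ ⊆ V}.ncard ≤ 3 := by
  obtain ⟨δ, hδ, h⟩ := exists_uniform_card_orbits_le_three (D := D) hD
    (fun p hp => by linarith [(hcond _ _ _ _ _ _ hp).2.1])
    (fun p hp => by
      obtain ⟨h1, h2, h3⟩ := hcond _ _ _ _ _ _ hp
      refine KuklesParam.nonFlat h1 (by linarith) fun h0 => ?_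
      rw [h0.1, h0.2.1, h0.2.2] at h3
      simp at h3)
  refine ⟨ball 0 δ, ball_mem_nhds _ hδ, fun a11 a02 a30 a21 a12 a03 hp => ?_⟩
  refine Set.finite_and_ncard_le_of_finset fun S hS => h _ hp S fun Γ hΓ => ?_
  obtain ⟨⟨⟨γ, T, hT, hsol, hper, hne, rfl⟩, -⟩, hsub⟩ := hS hΓ
  refine ⟨⟨γ, T, hT, fun t => (hsol t).1.prodMk (hsol t).2, hper, hne, rfl⟩, fun z hz => ?_⟩
  have := hsub hz
  rw [mem_ball_zero_iff] at this
  exact (norm_snd_le z).trans_lt this
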